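/- Let u ≥ 2 and let F be a fixed nice u-graph with r = v(F) ≥ 4 vertices and s = e(F) edges, and fix g = g(n) with g(n) → ∞ and g(n) = o(log n/log log n). There exists a constant δ = δ(F) > 0 such that, with π_+ = (aut(F)/r!)·(log n + g(n))/binom(n−1,r−1) and p_+ = (π_+/(1−n^{−δ}))^{1/s}, for all sufficiently large n there is a coupling μ of G = H_u(n,p_+) and H = H_F(n,π_+) with the following two properties. First, with probability tending to 1 as n → ∞, every F-edge of H is present as a subgraph (copy of F) in G. Second, for every F-graph H_0 on [n] with μ(H = H_0) > 0 that satisfies: no vertex of H_0 has degree more than d̄(π_+) + max(d̄(π_+), 3 log n), where d̄(π) = (r/n)·M·π, and the r-uniform multihypergraph of vertex sets of the F-edges of H_0 contains no avoidable configuration; and for every F-edge h_j ∉ H_0, the conditional probability under μ that the copy of F corresponding to h_j is a subgraph of G, given H = H_0, is at most (π_j* − π_+)/(1 − π_+), where π_j* = p_+^{|E_j \ E(G_0)|}, E_j is the u-edge set of the copy corresponding to h_j, and G_0 = G(H_0) is the union of the u-edge sets of all copies belonging to H_0. -/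

import Mathlib

open Classical Filter Asymptotics MeasureTheory
open scoped ENNReal

noncomputable section

/-- The type of potential `F`-edges on vertex set `Fin n`: a pair consisting of the
`r`-element vertex set of the copy and the `u`-edge set of the copy. -/
abbrev FE (n : ℕ) := Finset (Fin n) × Finset (Finset (Fin n))

/-- `F` (a `u`-graph on `Fin r`) is strictly 1-balanced: every proper subgraph `(V', E')`
with more than one vertex has strictly smaller 1-density, i.e.
`e'/(v'-1) < e(F)/(r-1)`, written multiplicatively. -/
def StrictlyOneBalanced {r : ℕ} (F : Finset (Finset (Fin r))) : Prop :=
  ∀ (V' : Finset (Fin r)) (E' : Finset (Finset (Fin r))),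
    E' ⊆ F → (∀ e ∈ E', e ⊆ V') → 1 < V'.card → ¬(V' = Finset.univ ∧ E' = F) →
      E'.card * (r - 1) < F.card * (V'.card - 1)

/-- After deleting the vertices in `S`, the hypergraph `F` is connected. -/
def ConnectedAvoiding {r : ℕ} (F : Finset (Finset (Fin r))) (S : Finset (Fin r)) : Prop :=
  ∀ x y : Fin r, x ∉ S → y ∉ S →
    Relation.ReflTransGen (fun a b => ∃ e ∈ F, Disjoint e S ∧ a ∈ e ∧ b ∈ e) x y

/-- `F` is 3-connected: at least 4 vertices, and no set of at most 2 vertices disconnects it. -/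
def ThreeConnected {r : ℕ} (F : Finset (Finset (Fin r))) : Prop :=
  4 ≤ r ∧ ∀ S : Finset (Fin r), S.card ≤ 2 → ConnectedAvoiding F S

/-- Two edge sets on `Fin r` are isomorphic via a permutation of the vertices. -/
def EdgeIso {r : ℕ} (F F' : Finset (Finset (Fin r))) : Prop :=
  ∃ σ : Equiv.Perm (Fin r), F.image (fun e => e.image (fun x => σ x)) = F'

/-- `F` is nice: strictly 1-balanced, 3-connected and either `u ≥ 3` or `u = 2` and `F`
cannot be transformed into an isomorphic graph by adding one edge and deleting one edge. -/
def Nice {r : ℕ} (u : ℕ) (F : Finset (Finset (Fin r))) : Prop :=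
  StrictlyOneBalanced F ∧ ThreeConnected F ∧
    (3 ≤ u ∨ (u = 2 ∧ ¬ ∃ a b : Finset (Fin r), a.card = u ∧ a ∉ F ∧ b ∈ F ∧
      EdgeIso (insert a (F.erase b)) F))

/-- `h` is an `F`-edge on `[n]`: a copy of `F`, recorded as its (`r`-element) vertex set
together with its `u`-edge set. -/
def IsFEdge {r : ℕ} (F : Finset (Finset (Fin r))) (n : ℕ) (h : FE n) : Prop :=
  ∃ φ : Fin r ↪ Fin n, h.1 = Finset.univ.map φ ∧ h.2 = F.image (fun e => e.map φ)

/-- All possible `F`-edges on `[n]`. -/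
def allFEdges {r : ℕ} (F : Finset (Finset (Fin r))) (n : ℕ) : Finset (FE n) :=
  Finset.univ.filter (fun h => IsFEdge F n h)

/-- `M`, the total number of `F`-edges on `[n]`. -/
def Mnum {r : ℕ} (F : Finset (Finset (Fin r))) (n : ℕ) : ℕ := (allFEdges F n).card

/-- All `u`-element subsets of `[n]`. -/
def allUEdges (u n : ℕ) : Finset (Finset (Fin n)) :=
  Finset.univ.filter (fun e : Finset (Fin n) => e.card = u)

/-- The number of automorphisms of `F`. -/
def autCard {r : ℕ} (F : Finset (Finset (Fin r))) : ℕ :=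
  Fintype.card {σ : Equiv.Perm (Fin r) // F.image (fun e => e.image (fun x => σ x)) = F}

/-- The degree of a vertex `v` in an `F`-graph `H`. -/
def degFE {n : ℕ} (H : Finset (FE n)) (v : Fin n) : ℕ :=
  (H.filter (fun h => v ∈ h.1)).card

/-- Two `F`-edges are partners if their vertex sets share exactly `u` vertices. -/
def Partner (u : ℕ) {n : ℕ} (h h' : FE n) : Prop :=
  h ≠ h' ∧ (h.1 ∩ h'.1).card = u

/-- The state at time `t` of the process induced by the ordering `f`. -/
def proc {α : Type*} [DecidableEq α] {m : ℕ} (f : Fin m → α) (t : ℕ) : Finset α :=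
  (Finset.univ.filter (fun i : Fin m => (i : ℕ) < t)).image f

/-- A valid ordering of all `u`-element subsets of `[n]`. -/
def ValidOrdU (u n : ℕ) (f : Fin (Nat.choose n u) → Finset (Fin n)) : Prop :=
  Function.Injective f ∧ ∀ e : Finset (Fin n), e.card = u → ∃ i, f i = e

/-- A valid ordering of all `r`-element subsets of `[n]`. -/
def ValidOrdR (r n : ℕ) (f : Fin (Nat.choose n r) → Finset (Fin n)) : Prop :=
  Function.Injective f ∧ ∀ e : Finset (Fin n), e.card = r → ∃ i, f i = e

/-- A valid ordering of all `F`-edges on `[n]`. -/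
def ValidOrdH {r : ℕ} (F : Finset (Finset (Fin r))) (n : ℕ)
    (f : Fin (Mnum F n) → FE n) : Prop :=
  Function.Injective f ∧ ∀ h : FE n, IsFEdge F n h → ∃ i, f i = h

/-- `T_H`: the first time at which the `F`-graph process has no isolated vertices. -/
def THit {r : ℕ} (F : Finset (Finset (Fin r))) (n : ℕ) (f : Fin (Mnum F n) → FE n) : ℕ :=
  sInf {t : ℕ | ∀ v : Fin n, ∃ h ∈ proc f t, v ∈ h.1}

/-- `T_E`: the first time at which the `r`-uniform hypergraph process has no isolated
vertices. -/
def TEHit (r n : ℕ) (f : Fin (Nat.choose n r) → Finset (Fin n)) : ℕ :=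
  sInf {t : ℕ | ∀ v : Fin n, ∃ e ∈ proc f t, v ∈ e}

/-- `T_G`: the first time at which every vertex of `[n]` lies in a copy of `F` in the
`u`-graph process. -/
def TGHit (u : ℕ) {r : ℕ} (F : Finset (Finset (Fin r))) (n : ℕ)
    (f : Fin (Nat.choose n u) → Finset (Fin n)) : ℕ :=
  sInf {t : ℕ | ∀ v : Fin n, ∃ h : FE n, IsFEdge F n h ∧ v ∈ h.1 ∧ h.2 ⊆ proc f t}

/-- The random variable `X` is uniformly distributed over `{a | P a}` under `μ`. -/
def UniformOn {Ω α : Type*} (μ : PMF Ω) (X : Ω → α) (P : α → Prop) : Prop :=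
  μ.toOuterMeasure {ω | P (X ω)} = 1 ∧
    ∀ a b : α, P a → P b →
      μ.toOuterMeasure {ω | X ω = a} = μ.toOuterMeasure {ω | X ω = b}

/-- Under `μ`, the random set `X` contains each element of `all` independently with
probability `p` (a Bernoulli product / binomial random subset distribution). -/
def BernoulliVia {Ω E : Type*} (μ : PMF Ω) (X : Ω → Finset E)
    (all : Finset E) (p : ℝ) : Prop :=
  ∀ A : Finset E, μ.toOuterMeasure {ω | X ω = A} =
    if A ⊆ all then ENNReal.ofReal (p ^ A.card * (1 - p) ^ (all.card - A.card)) else 0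

/-- The function `g` tends to infinity and is `o(log n / log log n)`. -/
def GoodG (g : ℕ → ℝ) : Prop :=
  Tendsto g atTop atTop ∧ g =o[atTop] fun n : ℕ => Real.log n / Real.log (Real.log n)

/-- `π₊`, the probability at the end of the critical window. -/
def piPlus {r : ℕ} (F : Finset (Finset (Fin r))) (g : ℕ → ℝ) (n : ℕ) : ℝ :=
  ((autCard F : ℝ) / (Nat.factorial r : ℝ)) *
    ((Real.log n + g n) / ((n - 1).choose (r - 1) : ℝ))

/-- `π₋`, the probability at the start of the critical window. -/
def piMinus {r : ℕ} (F : Finset (Finset (Fin r))) (g : ℕ → ℝ) (n : ℕ) : ℝ :=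
  ((autCard F : ℝ) / (Nat.factorial r : ℝ)) *
    ((Real.log n - g n) / ((n - 1).choose (r - 1) : ℝ))

/-- `p₊ = (π₊/(1-n^{-δ}))^{1/s}` where `s = e(F)`. -/
def pPlus {r : ℕ} (F : Finset (Finset (Fin r))) (g : ℕ → ℝ) (δ : ℝ) (n : ℕ) : ℝ :=
  (piPlus F g n / (1 - (n : ℝ) ^ (-δ))) ^ ((1 : ℝ) / (F.card : ℝ))

/-- Connectivity (as a multihypergraph of vertex sets) of a set of `F`-edges. -/
def ConnFE {n : ℕ} (S : Finset (FE n)) : Prop :=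
  ∀ a ∈ S, ∀ b ∈ S,
    Relation.ReflTransGen (fun x y : FE n => x ∈ S ∧ y ∈ S ∧ (x.1 ∩ y.1).Nonempty) a b

/-- The multihypergraph of vertex sets of the `F`-edges of `H` contains an avoidable
configuration: a connected `S ⊆ H` with nullity `(r-1)e(S)+1-v(S) > 1` and
`e(S) ≤ 2^(r+1)`. -/
def HasAvoidable (r : ℕ) {n : ℕ} (H : Finset (FE n)) : Prop :=
  ∃ S ⊆ H, S.Nonempty ∧ ConnFE S ∧
    (S.sup Prod.fst).card < (r - 1) * S.card ∧ S.card ≤ 2 ^ (r + 1)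

/-- `G` contains an `F`-factor: pairwise vertex-disjoint copies of `F`, each a subgraph
of `G`, whose vertex sets partition `[n]`. -/
def HasFFactor {r : ℕ} (F : Finset (Finset (Fin r))) (n : ℕ)
    (G : Finset (Finset (Fin n))) : Prop :=
  ∃ C : Finset (FE n), (∀ h ∈ C, IsFEdge F n h ∧ h.2 ⊆ G) ∧
    (∀ h ∈ C, ∀ h' ∈ C, h ≠ h' → Disjoint h.1 h'.1) ∧
    C.sup Prod.fst = Finset.univ ∧ C.card * r = n

set_option linter.unusedSectionVars false
set_option linter.unusedSimpArgs false
set_option linter.unusedDecidableInType false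

section Coupling

variable {α ι : Type*} [DecidableEq α] [Fintype α] [DecidableEq ι] [Fintype ι]

/-- Bernoulli weight of `G` as a random subset of `U`. -/
def bw {α : Type*} [DecidableEq α] (U : Finset α) (p : ℝ) (G : Finset α) : ℝ :=
  if G ⊆ U then p ^ G.card * (1 - p) ^ (U.card - G.card) else 0

lemma bw_nonneg {U : Finset α} {p : ℝ} (h0 : 0 ≤ p) (h1 : p ≤ 1) (G : Finset α) :
    0 ≤ bw U p G := by
  unfold bw
  have : 0 ≤ 1 - p := by linarith
  split_ifs <;> positivity

lemma bw_total (U : Finset α) (p : ℝ) : ∑ G : Finset α, bw U p G = 1 := by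
  have := Finset.sum_pow_mul_eq_add_pow p (1 - p) U
  simp only [add_sub_cancel, one_pow] at this
  rw [← this]
  unfold bw
  rw [← Finset.sum_filter]
  apply Finset.sum_congr _ (fun _ _ => rfl)
  ext G; simp

lemma bw_insert {U : Finset α} {p : ℝ} {x : α} {G : Finset α} (hx : x ∈ U) (hG : x ∉ G) :
    bw U p (insert x G) * (1 - p) = p * bw U p G := by
  unfold bw
  by_cases h : G ⊆ U
  · have h2 : insert x G ⊆ U := Finset.insert_subset hx h
    rw [if_pos h, if_pos h2, Finset.card_insert_of_notMem hG]
    have h3 := Finset.card_le_card h2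
    rw [Finset.card_insert_of_notMem hG] at h3
    obtain ⟨k, hk⟩ := Nat.exists_eq_add_of_le h3
    rw [hk, show G.card + 1 + k - (G.card + 1) = k by omega,
      show G.card + 1 + k - G.card = k + 1 by omega]
    ring
  · have h2 : ¬ insert x G ⊆ U := fun h2 => h ((Finset.subset_insert _ _).trans h2)
    rw [if_neg h, if_neg h2]; ring

lemma bw_insert_ext {U : Finset α} {p : ℝ} {x : α} {G : Finset α} (hx : x ∉ U) (hG : x ∉ G) :
    bw (insert x U) p (insert x G) = p * bw U p G := by
  unfold bw
  have e : insert x G ⊆ insert x U ↔ G ⊆ U := Finset.insert_subset_insert_iff hG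
  simp only [e]
  split_ifs with h
  · rw [Finset.card_insert_of_notMem hG, Finset.card_insert_of_notMem hx]
    rw [Nat.add_sub_add_right]; ring
  · ring

lemma bw_insert_ext' {U : Finset α} {p : ℝ} {x : α} {G : Finset α} (hx : x ∉ U) (hG : x ∉ G) :
    bw (insert x U) p G = (1 - p) * bw U p G := by
  unfold bw
  have e : G ⊆ insert x U ↔ G ⊆ U := Finset.subset_insert_iff_of_notMem hG
  simp only [e]
  split_ifs with h
  · rw [Finset.card_insert_of_notMem hx, Nat.succ_sub (Finset.card_le_card h), pow_succ]; ring
  · ring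

lemma bw_supermod {U : Finset α} {p : ℝ} (h0 : 0 ≤ p) (h1 : p ≤ 1) (a b : Finset α) :
    bw U p a * bw U p b ≤ bw U p (a ⊓ b) * bw U p (a ⊔ b) := by
  by_cases ha : a ⊆ U
  · by_cases hb : b ⊆ U
    · have hi : a ⊓ b ⊆ U := Finset.inter_subset_left.trans ha
      have hu : a ⊔ b ⊆ U := Finset.union_subset ha hb
      unfold bw
      rw [if_pos ha, if_pos hb, if_pos hi, if_pos hu]
      apply le_of_eq
      have hc : (a ⊓ b).card + (a ⊔ b).card = a.card + b.card := Finset.card_inter_add_card_union a b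
      have c1 := Finset.card_le_card ha
      have c2 := Finset.card_le_card hb
      have c3 := Finset.card_le_card hi
      have c4 := Finset.card_le_card hu
      calc _ = p ^ (a.card + b.card) * (1 - p) ^ ((U.card - a.card) + (U.card - b.card)) := by ring
        _ = p ^ ((a ⊓ b).card + (a ⊔ b).card) *
            (1 - p) ^ ((U.card - (a ⊓ b).card) + (U.card - (a ⊔ b).card)) := by
          rw [hc]; congr 2; omega
        _ = _ := by ring
    · have : bw U p b = 0 := if_neg hb
      rw [this, mul_zero]
      exact mul_nonneg (bw_nonneg h0 h1 _) (bw_nonneg h0 h1 _)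
  · have : bw U p a = 0 := if_neg ha
    rw [this, zero_mul]
    exact mul_nonneg (bw_nonneg h0 h1 _) (bw_nonneg h0 h1 _)

/-- Split a sum over finsets according to membership of `x`. -/
lemma sum_split_mem (x : α) (f : Finset α → ℝ) :
    ∑ G : Finset α, f G = ∑ G : Finset α, if x ∈ G then 0 else (f (insert x G) + f G) := by
  have h1 : ∑ G : Finset α, f G = (∑ G ∈ Finset.univ.filter (fun G : Finset α => x ∈ G), f G) +
      ∑ G ∈ Finset.univ.filter (fun G : Finset α => ¬ x ∈ G), f G :=
    (Finset.sum_filter_add_sum_filter_not _ _ _).symm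
  have h2 : (∑ G : Finset α, if x ∈ G then 0 else (f (insert x G) + f G)) =
      ∑ G ∈ Finset.univ.filter (fun G : Finset α => ¬ x ∈ G), (f (insert x G) + f G) := by
    rw [Finset.sum_filter]
    apply Finset.sum_congr rfl
    intro G _
    by_cases h : x ∈ G <;> simp [h]
  rw [h1, h2, Finset.sum_add_distrib]
  congr 1
  symm
  apply Finset.sum_bij (fun G _ => insert x G)
  · intro G _; simp
  · intro a ha b hb hab
    simp only [Finset.mem_filter, Finset.mem_univ, true_and] at ha hb
    rw [← Finset.erase_insert ha, ← Finset.erase_insert hb, hab]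
  · intro b hb
    simp only [Finset.mem_filter, Finset.mem_univ, true_and] at hb
    exact ⟨b.erase x, by simp, Finset.insert_erase hb⟩
  · intro a _; rfl

lemma bw_sum_insert {U : Finset α} {p : ℝ} {x : α} (hx : x ∈ U) (f : Finset α → ℝ)
    (hf : ∀ G, x ∉ G → f (insert x G) = f G) :
    ∑ G : Finset α, (if x ∈ G then bw U p G * f G else 0) = p * ∑ G : Finset α, bw U p G * f G := by
  rw [sum_split_mem x, sum_split_mem x (fun G => bw U p G * f G), Finset.mul_sum]
  apply Finset.sum_congr rfl
  intro G _
  by_cases h : x ∈ G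
  · simp [h]
  · have := bw_insert (p := p) hx h
    simp only [h, if_false, Finset.mem_insert_self, if_true, add_zero, hf G h]
    linear_combination (f G) * this

variable (U : Finset α) (p : ℝ) (E : ι → Finset α)

/-- The conditioning event: `R` present, none of the `E i`, `i ∈ N`, present. -/
def Ok {α ι : Type*} (E : ι → Finset α) (R : Finset α) (N : Finset ι) (G : Finset α) : Prop :=
  R ⊆ G ∧ ∀ i ∈ N, ¬ E i ⊆ G

/-- Probability of the conditioning event. -/
def Zf (R : Finset α) (N : Finset ι) : ℝ :=
  ∑ G : Finset α, bw U p G * (if Ok E R N G then 1 else 0)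

lemma Zf_insert {R : Finset α} {N : Finset ι} {x : α} (hx : x ∈ U) (hR : x ∉ R)
    (hN : ∀ i ∈ N, x ∉ E i) : Zf U p E (insert x R) N = p * Zf U p E R N := by
  unfold Zf
  rw [← bw_sum_insert hx]
  · apply Finset.sum_congr rfl
    intro G _
    by_cases h : x ∈ G
    · have : Ok E (insert x R) N G ↔ Ok E R N G := by simp [h, Ok, Finset.insert_subset_iff]
      simp only [this, h, if_true]
    · simp [h, Ok, Finset.insert_subset_iff]
  · intro G hG
    have : Ok E R N (insert x G) ↔ Ok E R N G := by
      unfold Ok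
      rw [Finset.subset_insert_iff_of_notMem hR]
      apply and_congr_right
      intro _
      apply forall₂_congr
      intro i hi
      rw [Finset.subset_insert_iff_of_notMem (hN i hi)]
    simp only [this]

lemma Zf_union {R : Finset α} {N : Finset ι} (T : Finset α) (hT : T ⊆ U) (hR : Disjoint T R)
    (hN : ∀ i ∈ N, Disjoint (E i) T) : Zf U p E (R ∪ T) N = p ^ T.card * Zf U p E R N := by
  induction T using Finset.induction_on with
  | empty => simp
  | insert x T hx ih =>
    have h1 : T ⊆ U := (Finset.subset_insert _ _).trans hT
    have h2 : Disjoint T R := hR.mono_left (Finset.subset_insert _ _)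
    have h3 : ∀ i ∈ N, Disjoint (E i) T := fun i hi => (hN i hi).mono_right (Finset.subset_insert _ _)
    rw [Finset.union_insert, Zf_insert U p E (hT (Finset.mem_insert_self _ _)), ih h1 h2 h3,
      Finset.card_insert_of_notMem hx]
    · ring
    · have := Finset.disjoint_left.1 hR (Finset.mem_insert_self x T)
      simp [hx, this]
    · intro i hi
      exact Finset.disjoint_right.1 (hN i hi) (Finset.mem_insert_self x T)

lemma Zf_sdiff {R : Finset α} {N : Finset ι} (T : Finset α) (hT : T ⊆ U)
    (hN : ∀ i ∈ N, Disjoint (E i) (T \ R)) :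
    Zf U p E (R ∪ T) N = p ^ (T \ R).card * Zf U p E R N := by
  rw [← Zf_union U p E (T \ R) (Finset.sdiff_subset.trans hT) Finset.sdiff_disjoint hN,
    Finset.union_sdiff_self_eq_union]

lemma Zf_empty (R : Finset α) (hR : R ⊆ U) : Zf U p E R ∅ = p ^ R.card := by
  have h := Zf_sdiff U p E (R := ∅) (N := ∅) R hR (by simp)
  rw [Finset.empty_union, Finset.sdiff_empty] at h
  have h2 : Zf U p E ∅ ∅ = 1 := by
    unfold Zf
    simp [Ok, bw_total]
  rw [h, h2, mul_one]

/-- Probability that a Bernoulli set contains `R`. -/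
lemma bw_contains (R : Finset α) (hR : R ⊆ U) :
    ∑ G : Finset α, (if R ⊆ G then bw U p G else 0) = p ^ R.card := by
  rw [← Zf_empty U p (fun i : Empty => i.elim) R hR]
  unfold Zf
  apply Finset.sum_congr rfl
  intro G _
  simp [Ok]

variable {p}

lemma Zf_nonneg (hp0 : 0 ≤ p) (hp1 : p ≤ 1) (R : Finset α) (N : Finset ι) : 0 ≤ Zf U p E R N := by
  unfold Zf
  apply Finset.sum_nonneg
  intro G _
  exact mul_nonneg (bw_nonneg hp0 hp1 _) (by split_ifs <;> norm_num)

lemma Zf_mono (hp0 : 0 ≤ p) (hp1 : p ≤ 1) {R R' : Finset α} {N N' : Finset ι} (hR : R ⊆ R') (hN : N ⊆ N') :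
    Zf U p E R' N' ≤ Zf U p E R N := by
  unfold Zf
  apply Finset.sum_le_sum
  intro G _
  apply mul_le_mul_of_nonneg_left _ (bw_nonneg hp0 hp1 _)
  by_cases h : Ok E R' N' G
  · have : Ok E R N G := ⟨hR.trans h.1, fun i hi => h.2 i (hN hi)⟩
    simp [h, this]
  · rw [if_neg h]; split_ifs <;> norm_num

/-- Harris: conditioning on a decreasing event decreases the probability of an increasing one. -/
lemma Zf_harris (hp0 : 0 ≤ p) (hp1 : p ≤ 1) (R T : Finset α) (N : Finset ι) :
    Zf U p E (R ∪ T) N * Zf U p E R ∅ ≤ Zf U p E (R ∪ T) ∅ * Zf U p E R N := by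
  have key := fkg (α := Finset α) (β := ℝ)
    (f := fun G => if T ⊆ G then 1 else 0)
    (g := fun G => if ∃ i ∈ N, E i ⊆ G then 1 else 0)
    (μ := fun G => bw U p G * (if R ⊆ G then 1 else 0))
    (by intro G; exact mul_nonneg (bw_nonneg hp0 hp1 _) (by split_ifs <;> norm_num))
    (by intro G; dsimp only; split_ifs <;> simp)
    (by intro G; dsimp only; split_ifs <;> simp)
    (by
      intro a b hab
      dsimp only
      by_cases h : T ⊆ a
      · have : T ⊆ b := h.trans hab
        simp [h, this]
      · rw [if_neg h]; split_ifs <;> norm_num)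
    (by
      intro a b hab
      dsimp only
      by_cases h : ∃ i ∈ N, E i ⊆ a
      · have : ∃ i ∈ N, E i ⊆ b := by
          obtain ⟨i, hi, h⟩ := h
          exact ⟨i, hi, h.trans hab⟩
        rw [if_pos h, if_pos this]
      · rw [if_neg h]; split_ifs <;> norm_num)
    (by
      intro a b
      have hn := bw_nonneg (U := U) hp0 hp1
      by_cases ha : R ⊆ a
      · by_cases hb : R ⊆ b
        · have h1 : R ⊆ a ⊓ b := Finset.subset_inter ha hb
          have h2 : R ⊆ a ⊔ b := ha.trans Finset.subset_union_left
          rw [if_pos ha, if_pos hb, if_pos h1, if_pos h2]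
          simpa using bw_supermod hp0 hp1 a b
        · rw [if_neg hb, mul_zero, mul_zero]
          exact mul_nonneg (mul_nonneg (hn _) (by split_ifs <;> norm_num))
            (mul_nonneg (hn _) (by split_ifs <;> norm_num))
      · rw [if_neg ha, mul_zero, zero_mul]
        exact mul_nonneg (mul_nonneg (hn _) (by split_ifs <;> norm_num))
            (mul_nonneg (hn _) (by split_ifs <;> norm_num)))
  have e1 : ∑ G : Finset α, bw U p G * (if R ⊆ G then (1:ℝ) else 0) * (if T ⊆ G then 1 else 0) =
      Zf U p E (R ∪ T) ∅ := by
    unfold Zf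
    apply Finset.sum_congr rfl
    intro G _
    by_cases h1 : R ⊆ G <;> by_cases h2 : T ⊆ G <;> simp [Ok, h1, h2, Finset.union_subset_iff]
  have e2 : ∑ G : Finset α, bw U p G * (if R ⊆ G then (1:ℝ) else 0) *
      (if ∃ i ∈ N, E i ⊆ G then 1 else 0) = Zf U p E R ∅ - Zf U p E R N := by
    unfold Zf
    rw [← Finset.sum_sub_distrib]
    apply Finset.sum_congr rfl
    intro G _
    by_cases h1 : R ⊆ G <;> by_cases h2 : ∃ i ∈ N, E i ⊆ G
    · have : ¬ ∀ i ∈ N, ¬ E i ⊆ G := by push Not; exact h2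
      rw [if_pos h2]
      simp [Ok, h1]
      rw [if_neg this]; ring
    · have : ∀ i ∈ N, ¬ E i ⊆ G := by push Not at h2; exact h2
      rw [if_neg h2]
      simp [Ok, h1, this]
      rw [if_pos this]; ring
    · simp [Ok, h1]
    · simp [Ok, h1]
  have e3 : ∑ G : Finset α, bw U p G * (if R ⊆ G then (1:ℝ) else 0) *
      ((if T ⊆ G then 1 else 0) * (if ∃ i ∈ N, E i ⊆ G then 1 else 0)) =
      Zf U p E (R ∪ T) ∅ - Zf U p E (R ∪ T) N := by
    unfold Zf
    rw [← Finset.sum_sub_distrib]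
    apply Finset.sum_congr rfl
    intro G _
    by_cases h0 : T ⊆ G
    · by_cases h1 : R ⊆ G <;> by_cases h2 : ∃ i ∈ N, E i ⊆ G
      · have : ¬ ∀ i ∈ N, ¬ E i ⊆ G := by push Not; exact h2
        rw [if_pos h2]
        simp [Ok, h1, h0, Finset.union_subset_iff]
        rw [if_neg this]; ring
      · have : ∀ i ∈ N, ¬ E i ⊆ G := by push Not at h2; exact h2
        rw [if_neg h2]
        simp [Ok, h1, h0, this, Finset.union_subset_iff]
        rw [if_pos this]; ring
      · simp [Ok, h1, Finset.union_subset_iff]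
      · simp [Ok, h1, Finset.union_subset_iff]
    · simp [Ok, h0, Finset.union_subset_iff]
  have e4 : ∑ G : Finset α, bw U p G * (if R ⊆ G then (1:ℝ) else 0) = Zf U p E R ∅ := by
    unfold Zf
    simp [Ok]
  rw [e1, e2, e3, e4] at key
  nlinarith

lemma Zf_upper (hp1 : p ≤ 1) (hp0 : 0 < p) (R T : Finset α) (N : Finset ι) (hR : R ⊆ U) (hT : T ⊆ U) :
    Zf U p E (R ∪ T) N ≤ p ^ (T \ R).card * Zf U p E R N := by
  have h := Zf_harris U E hp0.le hp1 R T N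
  rw [Zf_sdiff U p E T hT (N := ∅) (by simp), Zf_empty U p E R hR] at h
  have : 0 < p ^ R.card := pow_pos hp0 _
  have h2 : Zf U p E (R ∪ T) N * p ^ R.card ≤ (p ^ (T \ R).card * Zf U p E R N) * p ^ R.card := by
    linarith
  exact le_of_mul_le_mul_right h2 this

/-- Lower bound on the conditional probability. -/
lemma Zf_lower (hp1 : p ≤ 1) (hp0 : 0 < p) (R T : Finset α) (N : Finset ι) (hR : R ⊆ U) (hT : T ⊆ U)
    (hE : ∀ i, E i ⊆ U) (ε : ℝ)
    (hQ : ∑ i ∈ N.filter (fun i => ¬ (E i ∩ T ⊆ R)), p ^ ((E i) \ (R ∪ T)).card ≤ ε) (hε : ε ≤ 1) :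
    p ^ (T \ R).card * (1 - ε) * Zf U p E R N ≤ Zf U p E (R ∪ T) N := by
  set N1 := N.filter (fun i => ¬ (E i ∩ T ⊆ R)) with hN1
  set N0 := N.filter (fun i => E i ∩ T ⊆ R) with hN0
  have h1 : Zf U p E (R ∪ T) N0 = p ^ (T \ R).card * Zf U p E R N0 := by
    apply Zf_sdiff U p E T hT
    intro i hi
    rw [hN0, Finset.mem_filter] at hi
    rw [Finset.disjoint_left]
    intro x hx hx2
    rw [Finset.mem_sdiff] at hx2
    exact hx2.2 (hi.2 (Finset.mem_inter.2 ⟨hx, hx2.1⟩))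
  have h2 : Zf U p E (R ∪ T) N0 ≤ Zf U p E (R ∪ T) N + ∑ i ∈ N1, Zf U p E (R ∪ T ∪ E i) N0 := by
    unfold Zf
    rw [Finset.sum_comm, ← Finset.sum_add_distrib]
    apply Finset.sum_le_sum
    intro G _
    rw [← Finset.mul_sum, ← mul_add]
    apply mul_le_mul_of_nonneg_left _ (bw_nonneg hp0.le hp1 _)
    have hnn : ∀ i ∈ N1, (0:ℝ) ≤ if Ok E (R ∪ T ∪ E i) N0 G then 1 else 0 := by
      intro i _; split_ifs <;> norm_num
    by_cases h : Ok E (R ∪ T) N0 G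
    · rw [if_pos h]
      by_cases h' : Ok E (R ∪ T) N G
      · rw [if_pos h']
        linarith [Finset.sum_nonneg hnn]
      · rw [if_neg h', zero_add]
        have : ∃ i ∈ N1, E i ⊆ G := by
          by_contra hcon
          push Not at hcon
          apply h'
          refine ⟨h.1, fun i hi => ?_⟩
          by_cases hc : E i ∩ T ⊆ R
          · exact h.2 i (Finset.mem_filter.2 ⟨hi, hc⟩)
          · exact hcon i (Finset.mem_filter.2 ⟨hi, hc⟩)
        obtain ⟨i, hi, hiG⟩ := this
        have h3 := Finset.single_le_sum hnn hi
        have h4 : Ok E (R ∪ T ∪ E i) N0 G := ⟨Finset.union_subset h.1 hiG, h.2⟩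
        rw [if_pos h4] at h3
        exact h3
    · rw [if_neg h]
      have := Finset.sum_nonneg hnn
      split_ifs <;> linarith
  have hZ0 : 0 ≤ Zf U p E R N0 := Zf_nonneg U E hp0.le hp1 _ _
  have h3 : ∑ i ∈ N1, Zf U p E (R ∪ T ∪ E i) N0 ≤ ε * (p ^ (T \ R).card * Zf U p E R N0) := by
    calc _ ≤ ∑ i ∈ N1, p ^ ((E i) \ (R ∪ T)).card * (p ^ (T \ R).card * Zf U p E R N0) := by
          apply Finset.sum_le_sum
          intro i _
          rw [← h1]
          exact Zf_upper U E hp1 hp0 (R ∪ T) (E i) N0 (Finset.union_subset hR hT) (hE i)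
      _ = (∑ i ∈ N1, p ^ ((E i) \ (R ∪ T)).card) * (p ^ (T \ R).card * Zf U p E R N0) := by
          rw [Finset.sum_mul]
      _ ≤ _ := by
          apply mul_le_mul_of_nonneg_right hQ
          positivity
  have h4 : Zf U p E R N ≤ Zf U p E R N0 :=
    Zf_mono U E hp0.le hp1 (Finset.Subset.refl _) (Finset.filter_subset _ _)
  have h5 : p ^ (T \ R).card * (1 - ε) * Zf U p E R N ≤
      p ^ (T \ R).card * (1 - ε) * Zf U p E R N0 := by
    apply mul_le_mul_of_nonneg_left h4
    have : 0 ≤ 1 - ε := by linarith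
    positivity
  rw [h1] at h2
  nlinarith

end Coupling

section Coupling2

variable {α ι : Type*} [DecidableEq α] [Fintype α] [DecidableEq ι] [Fintype ι]
variable (U : Finset α) (p : ℝ) (E : ι → Finset α)

/-- Conditional law of `G`. -/
def Pc (R : Finset α) (N : Finset ι) (G : Finset α) : ℝ :=
  bw U p G * (if Ok E R N G then 1 else 0) / Zf U p E R N

/-- Conditional probability that `T` is present. -/
def qc (R : Finset α) (N : Finset ι) (T : Finset α) : ℝ := Zf U p E (R ∪ T) N / Zf U p E R N

/-- Probability of not testing. -/
def epsc (pi q : ℝ) : ℝ := if pi ≤ q then 1 - pi / q else 0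

/-- The coupling kernel, by recursion on the list of remaining `F`-edges. -/
def Kc (pi : ℝ) : List ι → Finset α → Finset ι → Finset α → Finset ι → ℝ
  | [], R, N, G, H => if H = ∅ then Pc U p E R N G else 0
  | h :: L, R, N, G, H =>
    if h ∈ H then
      min pi (qc U p E R N (E h)) * Kc pi L (R ∪ E h) N G (H.erase h) +
      (pi - min pi (qc U p E R N (E h))) * Kc pi L R (insert h N) G (H.erase h)
    else
      (1 - pi - epsc pi (qc U p E R N (E h))) * Kc pi L R (insert h N) G H +
      epsc pi (qc U p E R N (E h)) * Kc pi L R N G H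

lemma Kc_cons_mem (pi : ℝ) {h : ι} {L : List ι} {H : Finset ι} (hh : h ∈ H) (R : Finset α)
    (N : Finset ι) (G : Finset α) : Kc U p E pi (h :: L) R N G H =
      min pi (qc U p E R N (E h)) * Kc U p E pi L (R ∪ E h) N G (H.erase h) +
      (pi - min pi (qc U p E R N (E h))) * Kc U p E pi L R (insert h N) G (H.erase h) := by
  rw [Kc, if_pos hh]

lemma Kc_cons_notMem (pi : ℝ) {h : ι} {L : List ι} {H : Finset ι} (hh : h ∉ H) (R : Finset α)
    (N : Finset ι) (G : Finset α) : Kc U p E pi (h :: L) R N G H =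
      (1 - pi - epsc pi (qc U p E R N (E h))) * Kc U p E pi L R (insert h N) G H +
      epsc pi (qc U p E R N (E h)) * Kc U p E pi L R N G H := by
  rw [Kc, if_neg hh]

lemma Kc_supp (pi : ℝ) (L : List ι) : ∀ (R : Finset α) (N : Finset ι) (G : Finset α) (H : Finset ι),
    Kc U p E pi L R N G H ≠ 0 → Ok E R N G ∧ H ⊆ L.toFinset := by
  induction L with
  | nil =>
    intro R N G H h
    rw [Kc] at h
    split_ifs at h with h1
    · subst h1
      refine ⟨?_, by simp⟩
      by_contra h2
      apply h
      simp [Pc, h2]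
    · exact absurd rfl h
  | cons a L ih =>
    intro R N G H h
    by_cases ha : a ∈ H
    · rw [Kc_cons_mem U p E pi ha] at h
      have : Kc U p E pi L (R ∪ E a) N G (H.erase a) ≠ 0 ∨
          Kc U p E pi L R (insert a N) G (H.erase a) ≠ 0 := by
        by_contra hc
        push Not at hc
        apply h
        rw [hc.1, hc.2]; ring
      rw [List.toFinset_cons]
      rcases this with h1 | h1
      · obtain ⟨h2, h3⟩ := ih _ _ _ _ h1
        exact ⟨⟨Finset.subset_union_left.trans h2.1, h2.2⟩,
          (Finset.insert_erase ha) ▸ Finset.insert_subset_insert a h3⟩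
      · obtain ⟨h2, h3⟩ := ih _ _ _ _ h1
        exact ⟨⟨h2.1, fun i hi => h2.2 i (Finset.mem_insert_of_mem hi)⟩,
          (Finset.insert_erase ha) ▸ Finset.insert_subset_insert a h3⟩
    · rw [Kc_cons_notMem U p E pi ha] at h
      have : Kc U p E pi L R (insert a N) G H ≠ 0 ∨ Kc U p E pi L R N G H ≠ 0 := by
        by_contra hc
        push Not at hc
        apply h
        rw [hc.1, hc.2]; ring
      rw [List.toFinset_cons]
      rcases this with h1 | h1
      · obtain ⟨h2, h3⟩ := ih _ _ _ _ h1
        exact ⟨⟨h2.1, fun i hi => h2.2 i (Finset.mem_insert_of_mem hi)⟩,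
          h3.trans (Finset.subset_insert _ _)⟩
      · obtain ⟨h2, h3⟩ := ih _ _ _ _ h1
        exact ⟨h2, h3.trans (Finset.subset_insert _ _)⟩

lemma Zf_split (R : Finset α) (N : Finset ι) (h : ι) :
    Zf U p E R N = Zf U p E (R ∪ E h) N + Zf U p E R (insert h N) := by
  unfold Zf
  rw [← Finset.sum_add_distrib]
  apply Finset.sum_congr rfl
  intro G _
  rw [← mul_add]
  congr 1
  have e1 : Ok E (R ∪ E h) N G ↔ Ok E R N G ∧ E h ⊆ G := by
    simp only [Ok, Finset.union_subset_iff]; tauto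
  have e2 : Ok E R (insert h N) G ↔ Ok E R N G ∧ ¬ E h ⊆ G := by
    simp only [Ok, Finset.forall_mem_insert]; tauto
  simp only [e1, e2]
  by_cases h1 : Ok E R N G <;> by_cases h2 : E h ⊆ G <;> simp [h1, h2]

variable {p} {pi : ℝ}

lemma qc_nonneg (hp0 : 0 < p) (hp1 : p ≤ 1) (R : Finset α) (N : Finset ι) (T : Finset α) : 0 ≤ qc U p E R N T :=
  div_nonneg (Zf_nonneg U E hp0.le hp1 _ _) (Zf_nonneg U E hp0.le hp1 _ _)

lemma qc_le_one (hp0 : 0 < p) (hp1 : p ≤ 1) (R : Finset α) (N : Finset ι) (T : Finset α) : qc U p E R N T ≤ 1 :=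
  div_le_one_of_le₀ (Zf_mono U E hp0.le hp1 Finset.subset_union_left (Finset.Subset.refl _))
    (Zf_nonneg U E hp0.le hp1 _ _)

lemma Pc_nonneg (hp0 : 0 < p) (hp1 : p ≤ 1) (R : Finset α) (N : Finset ι) (G : Finset α) : 0 ≤ Pc U p E R N G :=
  div_nonneg (mul_nonneg (bw_nonneg hp0.le hp1 _) (by split_ifs <;> norm_num))
    (Zf_nonneg U E hp0.le hp1 _ _)

lemma qc_upper (hp0 : 0 < p) (hp1 : p ≤ 1) (R : Finset α) (N : Finset ι) (T : Finset α) (hR : R ⊆ U) (hT : T ⊆ U) :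
    qc U p E R N T ≤ p ^ (T \ R).card :=
  div_le_of_le_mul₀ (Zf_nonneg U E hp0.le hp1 _ _) (by positivity)
    (Zf_upper U E hp1 hp0 R T N hR hT)

/-- If the normalizer vanishes then everything vanishes. -/
lemma Pc_split (hp0 : 0 < p) (hp1 : p ≤ 1) (R : Finset α) (N : Finset ι) (h : ι) (G : Finset α) :
    Pc U p E R N G = qc U p E R N (E h) * Pc U p E (R ∪ E h) N G +
      (1 - qc U p E R N (E h)) * Pc U p E R (insert h N) G := by
  have hs := Zf_split U p E R N h
  have n1 := Zf_nonneg U E hp0.le hp1 (R ∪ E h) N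
  have n2 := Zf_nonneg U E hp0.le hp1 R (insert h N)
  have e : bw U p G * (if Ok E R N G then 1 else 0) =
      bw U p G * (if Ok E (R ∪ E h) N G then 1 else 0) +
      bw U p G * (if Ok E R (insert h N) G then 1 else 0) := by
    rw [← mul_add]
    congr 1
    have e1 : Ok E (R ∪ E h) N G ↔ Ok E R N G ∧ E h ⊆ G := by
      simp only [Ok, Finset.union_subset_iff]; tauto
    have e2 : Ok E R (insert h N) G ↔ Ok E R N G ∧ ¬ E h ⊆ G := by
      simp only [Ok, Finset.forall_mem_insert]; tauto
    simp only [e1, e2]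
    by_cases h1 : Ok E R N G <;> by_cases h2 : E h ⊆ G <;> simp [h1, h2]
  -- pointwise bounds: each weight is at most the normalizer
  have b : ∀ (R : Finset α) (N : Finset ι), Zf U p E R N = 0 →
      bw U p G * (if Ok E R N G then 1 else 0) = 0 := by
    intro R N hz
    unfold Zf at hz
    rw [Finset.sum_eq_zero_iff_of_nonneg] at hz
    · exact hz G (Finset.mem_univ _)
    · intro G _
      exact mul_nonneg (bw_nonneg hp0.le hp1 _) (by split_ifs <;> norm_num)
  have b1 := b (R ∪ E h) N
  have b2 := b R (insert h N)
  unfold Pc qc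
  rw [e, hs]
  generalize bw U p G * (if Ok E (R ∪ E h) N G then 1 else 0) = x at *
  generalize bw U p G * (if Ok E R (insert h N) G then 1 else 0) = y at *
  generalize Zf U p E (R ∪ E h) N = z at *
  generalize Zf U p E R (insert h N) = w at *
  rcases eq_or_lt_of_le n1 with hz | hz
  · rw [b1 hz.symm, ← hz]; simp
  · rcases eq_or_lt_of_le n2 with hw | hw
    · rw [b2 hw.symm, ← hw]; field_simp; ring
    · have : z + w ≠ 0 := by positivity
      field_simp; ring


lemma epsc_bounds (hpi0 : 0 < pi) (hpi1 : pi < 1) {q : ℝ} (hq1 : q ≤ 1) : 0 ≤ epsc pi q ∧ epsc pi q ≤ 1 - pi := by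
  unfold epsc
  split_ifs with h
  · have hq : 0 < q := lt_of_lt_of_le hpi0 h
    have h1 : pi / q ≤ 1 := (div_le_one hq).2 h
    have h2 : pi ≤ pi / q := by rw [le_div_iff₀ hq]; nlinarith
    constructor <;> linarith
  · constructor <;> linarith

lemma Kc_nonneg (hp0 : 0 < p) (hp1 : p ≤ 1) (hpi0 : 0 < pi) (hpi1 : pi < 1) (L : List ι) : ∀ (R : Finset α) (N : Finset ι) (G : Finset α) (H : Finset ι),
    0 ≤ Kc U p E pi L R N G H := by
  induction L with
  | nil =>
    intro R N G H
    rw [Kc]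
    split_ifs
    · exact Pc_nonneg U E hp0 hp1 _ _ _
    · exact le_refl _
  | cons a L ih =>
    intro R N G H
    by_cases ha : a ∈ H
    · rw [Kc_cons_mem U p E pi ha]
      have h1 : 0 ≤ min pi (qc U p E R N (E a)) := le_min hpi0.le (qc_nonneg U E hp0 hp1 _ _ _)
      have h2 : 0 ≤ pi - min pi (qc U p E R N (E a)) := by linarith [min_le_left pi (qc U p E R N (E a))]
      exact add_nonneg (mul_nonneg h1 (ih _ _ _ _)) (mul_nonneg h2 (ih _ _ _ _))
    · rw [Kc_cons_notMem U p E pi ha]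
      obtain ⟨h1, h2⟩ := epsc_bounds hpi0 hpi1 (qc_le_one U E hp0 hp1 R N (E a))
      exact add_nonneg (mul_nonneg (by linarith) (ih _ _ _ _)) (mul_nonneg h1 (ih _ _ _ _))

lemma mix_identity (hpi0 : 0 < pi) (hpi1 : pi < 1) {q x y z : ℝ} (h : z = q * x + (1 - q) * y) :
    min pi q * x + (pi - min pi q) * y + ((1 - pi - epsc pi q) * y + epsc pi q * z) = z := by
  unfold epsc
  split_ifs with hq
  · have hq0 : 0 < q := lt_of_lt_of_le hpi0 hq
    rw [min_eq_left hq, h]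
    field_simp
    ring
  · rw [min_eq_right (not_le.1 hq).le, h]; ring

lemma Kc_sum_restrict (L : List ι) (a : ι) (ha : a ∉ L) (R : Finset α) (N : Finset ι)
    (G : Finset α) : (∑ H : Finset ι, if a ∈ H then 0 else Kc U p E pi L R N G H) =
      ∑ H : Finset ι, Kc U p E pi L R N G H := by
  apply Finset.sum_congr rfl
  intro H _
  split_ifs with h
  · by_contra hc
    have := (Kc_supp U p E pi L R N G H (Ne.symm hc)).2 h
    exact ha (List.mem_toFinset.1 this)
  · rfl

lemma Kc_margG (hp0 : 0 < p) (hp1 : p ≤ 1) (hpi0 : 0 < pi) (hpi1 : pi < 1) (L : List ι) : L.Nodup → ∀ (R : Finset α) (N : Finset ι) (G : Finset α),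
    ∑ H : Finset ι, Kc U p E pi L R N G H = Pc U p E R N G := by
  induction L with
  | nil =>
    intro _ R N G
    simp [Kc]
  | cons a L ih =>
    intro hL R N G
    rw [List.nodup_cons] at hL
    rw [sum_split_mem a]
    have e : ∀ H : Finset ι, (if a ∈ H then 0 else
        Kc U p E pi (a :: L) R N G (insert a H) + Kc U p E pi (a :: L) R N G H) =
        min pi (qc U p E R N (E a)) * (if a ∈ H then 0 else Kc U p E pi L (R ∪ E a) N G H) +
        (pi - min pi (qc U p E R N (E a))) * (if a ∈ H then 0 else Kc U p E pi L R (insert a N) G H) +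
        ((1 - pi - epsc pi (qc U p E R N (E a))) *
          (if a ∈ H then 0 else Kc U p E pi L R (insert a N) G H) +
        epsc pi (qc U p E R N (E a)) * (if a ∈ H then 0 else Kc U p E pi L R N G H)) := by
      intro H
      by_cases h : a ∈ H
      · simp [h]
      · simp only [h, if_false]
        rw [Kc_cons_mem U p E pi (Finset.mem_insert_self a H), Kc_cons_notMem U p E pi h,
          Finset.erase_insert h]
    simp only [e, Finset.sum_add_distrib, ← Finset.mul_sum]
    rw [Kc_sum_restrict U E L a hL.1, Kc_sum_restrict U E L a hL.1, Kc_sum_restrict U E L a hL.1]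
    rw [ih hL.2, ih hL.2, ih hL.2]
    exact mix_identity hpi0 hpi1 (Pc_split U E hp0 hp1 R N a G)

/-- Total mass of the conditional law (0 or 1). -/
def tauc (U : Finset α) (p : ℝ) (E : ι → Finset α) (R : Finset α) (N : Finset ι) : ℝ :=
  ∑ G : Finset α, Pc U p E R N G

lemma tauc_eq (R : Finset α) (N : Finset ι) :
    tauc U p E R N = if Zf U p E R N = 0 then 0 else 1 := by
  unfold tauc Pc
  rw [← Finset.sum_div]
  change Zf U p E R N / Zf U p E R N = _
  split_ifs with h
  · rw [h, div_zero]
  · exact div_self h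

lemma Kc_margH (hp0 : 0 < p) (hp1 : p ≤ 1) (hpi0 : 0 < pi) (hpi1 : pi < 1) (L : List ι) : L.Nodup → ∀ (R : Finset α) (N : Finset ι) (H : Finset ι),
    ∑ G : Finset α, Kc U p E pi L R N G H = tauc U p E R N * bw L.toFinset pi H := by
  induction L with
  | nil =>
    intro _ R N H
    simp only [Kc, List.toFinset_nil, bw, Finset.subset_empty]
    by_cases h : H = ∅
    · simp [h, tauc]
    · simp [h]
  | cons a L ih =>
    intro hL R N H
    rw [List.nodup_cons] at hL
    have ha : a ∉ L.toFinset := by simpa using hL.1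
    have hs := Zf_split U p E R N a
    have n1 := Zf_nonneg U E hp0.le hp1 (R ∪ E a) N
    have n2 := Zf_nonneg U E hp0.le hp1 R (insert a N)
    have t1 := tauc_eq (p := p) U E R N
    have t2 := tauc_eq (p := p) U E (R ∪ E a) N
    have t3 := tauc_eq (p := p) U E R (insert a N)
    set q := qc U p E R N (E a) with hq
    have f1 : min pi q * tauc U p E (R ∪ E a) N = min pi q * tauc U p E R N := by
      by_cases hz : Zf U p E (R ∪ E a) N = 0
      · have : q = 0 := by rw [hq, qc, hz, zero_div]
        rw [this, min_eq_right hpi0.le]; ring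
      · have : Zf U p E R N ≠ 0 := by
          intro h0; apply hz; linarith
        rw [t1, t2, if_neg hz, if_neg this]
    have hq1 : Zf U p E R N ≠ 0 → Zf U p E R (insert a N) = 0 → q = 1 := by
      intro h0 h1
      rw [hq, qc, hs, h1, add_zero]
      apply div_self
      intro h2; apply h0; linarith
    have f2 : (pi - min pi q) * tauc U p E R (insert a N) = (pi - min pi q) * tauc U p E R N := by
      by_cases hz : Zf U p E R (insert a N) = 0
      · by_cases h0 : Zf U p E R N = 0
        · rw [t1, t3, if_pos hz, if_pos h0]
        · rw [hq1 h0 hz, min_eq_left hpi1.le]; ring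
      · have : Zf U p E R N ≠ 0 := by
          intro h0; apply hz; linarith
        rw [t1, t3, if_neg hz, if_neg this]
    have f3 : (1 - pi - epsc pi q) * tauc U p E R (insert a N) =
        (1 - pi - epsc pi q) * tauc U p E R N := by
      by_cases hz : Zf U p E R (insert a N) = 0
      · by_cases h0 : Zf U p E R N = 0
        · rw [t1, t3, if_pos hz, if_pos h0]
        · rw [hq1 h0 hz, epsc, if_pos hpi1.le]; ring
      · have : Zf U p E R N ≠ 0 := by
          intro h0; apply hz; linarith
        rw [t1, t3, if_neg hz, if_neg this]
    by_cases h : a ∈ H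
    · simp only [Kc_cons_mem U p E pi h, Finset.sum_add_distrib, ← Finset.mul_sum]
      rw [ih hL.2, ih hL.2, List.toFinset_cons]
      have hb := bw_insert_ext (p := pi) ha (Finset.notMem_erase a H)
      rw [Finset.insert_erase h] at hb
      rw [hb]
      linear_combination (bw L.toFinset pi (H.erase a)) * (f1 + f2)
    · simp only [Kc_cons_notMem U p E pi h, Finset.sum_add_distrib, ← Finset.mul_sum]
      rw [ih hL.2, ih hL.2, List.toFinset_cons]
      rw [bw_insert_ext' (p := pi) ha h]
      linear_combination (bw L.toFinset pi H) * f3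

/-- Union of edge sets. -/
def Gof {α ι : Type*} [DecidableEq α] (E : ι → Finset α) (H : Finset ι) : Finset α := H.sup E

lemma Gof_erase (R : Finset α) (H : Finset ι) {a : ι} (ha : a ∈ H) :
    R ∪ E a ∪ Gof E (H.erase a) = R ∪ Gof E H := by
  conv_rhs => rw [← Finset.insert_erase ha]
  unfold Gof
  rw [Finset.sup_insert, Finset.union_assoc]
  rfl

lemma Kc_upper (hp0 : 0 < p) (hp1 : p ≤ 1) (hpi0 : 0 < pi) (hpi1 : pi < 1) (hE : ∀ i, E i ⊆ U) (T : Finset α) (hT : T ⊆ U) (L : List ι) : L.Nodup →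
    ∀ (R : Finset α) (N : Finset ι) (H : Finset ι), R ⊆ U →
    ∑ G : Finset α, (if T ⊆ G then Kc U p E pi L R N G H else 0) ≤
      p ^ (T \ (R ∪ Gof E H)).card * bw L.toFinset pi H := by
  induction L with
  | nil =>
    intro _ R N H hR
    simp only [Kc, List.toFinset_nil, bw, Finset.subset_empty]
    by_cases h : H = ∅
    · subst h
      simp only [if_true, Finset.card_empty, pow_zero, mul_one, Gof, Finset.sup_empty,
        Finset.bot_eq_empty, Finset.union_empty, Nat.sub_self, one_mul]
      have := qc_upper U E hp0 hp1 R N T hR hT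
      convert this using 1
      unfold qc Zf Pc
      rw [Finset.sum_div]
      apply Finset.sum_congr rfl
      intro G _
      have e1 : Ok E (R ∪ T) N G ↔ Ok E R N G ∧ T ⊆ G := by
        simp only [Ok, Finset.union_subset_iff]; tauto
      simp only [e1]
      by_cases h1 : Ok E R N G <;> by_cases h2 : T ⊆ G <;> simp [h1, h2, Zf]
    · simp [h]
  | cons a L ih =>
    intro hL R N H hR
    rw [List.nodup_cons] at hL
    have ha : a ∉ L.toFinset := by simpa using hL.1
    have hbn := bw_nonneg (U := L.toFinset) hpi0.le hpi1.le
    have hm0 : 0 ≤ min pi (qc U p E R N (E a)) := le_min hpi0.le (qc_nonneg U E hp0 hp1 _ _ _)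
    have hm1 : 0 ≤ pi - min pi (qc U p E R N (E a)) := by
      linarith [min_le_left pi (qc U p E R N (E a))]
    obtain ⟨he1, he2⟩ := epsc_bounds hpi0 hpi1 (qc_le_one U E hp0 hp1 R N (E a))
    by_cases h : a ∈ H
    · have e : ∀ G : Finset α, (if T ⊆ G then Kc U p E pi (a :: L) R N G H else 0) =
          min pi (qc U p E R N (E a)) *
            (if T ⊆ G then Kc U p E pi L (R ∪ E a) N G (H.erase a) else 0) +
          (pi - min pi (qc U p E R N (E a))) *
            (if T ⊆ G then Kc U p E pi L R (insert a N) G (H.erase a) else 0) := by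
        intro G
        by_cases hG : T ⊆ G
        · simp only [hG, if_true, Kc_cons_mem U p E pi h]
        · simp [hG]
      simp only [e, Finset.sum_add_distrib, ← Finset.mul_sum]
      have i1 := ih hL.2 (R ∪ E a) N (H.erase a) (Finset.union_subset hR (hE a))
      have i2 := ih hL.2 R (insert a N) (H.erase a) hR
      rw [Gof_erase E R H h] at i1
      have i3 : p ^ (T \ (R ∪ Gof E (H.erase a))).card ≤ p ^ (T \ (R ∪ Gof E H)).card := by
        apply pow_le_pow_of_le_one hp0.le hp1
        apply Finset.card_le_card
        apply Finset.sdiff_subset_sdiff (Finset.Subset.refl _)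
        apply Finset.union_subset_union (Finset.Subset.refl _)
        exact Finset.sup_mono (Finset.erase_subset _ _)
      have i4 := i2.trans (mul_le_mul_of_nonneg_right i3 (hbn _))
      have hb := bw_insert_ext (p := pi) ha (Finset.notMem_erase a H)
      rw [Finset.insert_erase h] at hb
      rw [List.toFinset_cons, hb]
      have j1 := mul_le_mul_of_nonneg_left i1 hm0
      have j2 := mul_le_mul_of_nonneg_left i4 hm1
      linarith
    · have e : ∀ G : Finset α, (if T ⊆ G then Kc U p E pi (a :: L) R N G H else 0) =
          (1 - pi - epsc pi (qc U p E R N (E a))) *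
            (if T ⊆ G then Kc U p E pi L R (insert a N) G H else 0) +
          epsc pi (qc U p E R N (E a)) *
            (if T ⊆ G then Kc U p E pi L R N G H else 0) := by
        intro G
        by_cases hG : T ⊆ G
        · simp only [hG, if_true, Kc_cons_notMem U p E pi h]
        · simp [hG]
      simp only [e, Finset.sum_add_distrib, ← Finset.mul_sum]
      have i1 := ih hL.2 R (insert a N) H hR
      have i2 := ih hL.2 R N H hR
      rw [List.toFinset_cons, bw_insert_ext' (p := pi) ha h]
      have j1 := mul_le_mul_of_nonneg_left i1 (by linarith : 0 ≤ 1 - pi - epsc pi (qc U p E R N (E a)))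
      have j2 := mul_le_mul_of_nonneg_left i2 he1
      linarith

lemma Kc_second (hp0 : 0 < p) (hp1 : p ≤ 1) (hpi0 : 0 < pi) (hpi1 : pi < 1) (hE : ∀ i, E i ⊆ U) (j : ι) (hj : pi ≤ p ^ (E j).card) (L : List ι) : L.Nodup →
    j ∈ L → ∀ (R : Finset α) (N : Finset ι) (H : Finset ι), R ⊆ U → j ∉ H →
    ∑ G : Finset α, (if E j ⊆ G then Kc U p E pi L R N G H else 0) ≤
      (p ^ (E j \ (R ∪ Gof E H)).card - pi) / (1 - pi) * bw L.toFinset pi H := by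
  induction L with
  | nil => intro _ h; simp at h
  | cons a L ih =>
    intro hL hjL R N H hR hjH
    have h1pi : 0 < 1 - pi := by linarith
    rw [List.nodup_cons] at hL
    have ha : a ∉ L.toFinset := by simpa using hL.1
    have hbn := bw_nonneg (U := L.toFinset) hpi0.le hpi1.le
    have hm0 : 0 ≤ min pi (qc U p E R N (E a)) := le_min hpi0.le (qc_nonneg U E hp0 hp1 _ _ _)
    have hm1 : 0 ≤ pi - min pi (qc U p E R N (E a)) := by
      linarith [min_le_left pi (qc U p E R N (E a))]
    obtain ⟨he1, he2⟩ := epsc_bounds hpi0 hpi1 (qc_le_one U E hp0 hp1 R N (E a))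
    by_cases h : a ∈ H
    · have hjL' : j ∈ L := by
        rcases List.mem_cons.1 hjL with h1 | h1
        · exact absurd (h1 ▸ h) hjH
        · exact h1
      have hjH' : j ∉ H.erase a := fun h => hjH (Finset.mem_of_mem_erase h)
      have e : ∀ G : Finset α, (if E j ⊆ G then Kc U p E pi (a :: L) R N G H else 0) =
          min pi (qc U p E R N (E a)) *
            (if E j ⊆ G then Kc U p E pi L (R ∪ E a) N G (H.erase a) else 0) +
          (pi - min pi (qc U p E R N (E a))) *
            (if E j ⊆ G then Kc U p E pi L R (insert a N) G (H.erase a) else 0) := by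
        intro G
        by_cases hG : E j ⊆ G
        · simp only [hG, if_true, Kc_cons_mem U p E pi h]
        · simp [hG]
      simp only [e, Finset.sum_add_distrib, ← Finset.mul_sum]
      have i1 := ih hL.2 hjL' (R ∪ E a) N (H.erase a) (Finset.union_subset hR (hE a)) hjH'
      have i2 := ih hL.2 hjL' R (insert a N) (H.erase a) hR hjH'
      rw [Gof_erase E R H h] at i1
      have i3 : (p ^ (E j \ (R ∪ Gof E (H.erase a))).card - pi) / (1 - pi) ≤
          (p ^ (E j \ (R ∪ Gof E H)).card - pi) / (1 - pi) := by
        apply div_le_div_of_nonneg_right _ h1pi.le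
        apply sub_le_sub_right
        apply pow_le_pow_of_le_one hp0.le hp1
        apply Finset.card_le_card
        apply Finset.sdiff_subset_sdiff (Finset.Subset.refl _)
        apply Finset.union_subset_union (Finset.Subset.refl _)
        exact Finset.sup_mono (Finset.erase_subset _ _)
      have i4 := i2.trans (mul_le_mul_of_nonneg_right i3 (hbn _))
      have hb := bw_insert_ext (p := pi) ha (Finset.notMem_erase a H)
      rw [Finset.insert_erase h] at hb
      rw [List.toFinset_cons, hb]
      have j1 := mul_le_mul_of_nonneg_left i1 hm0
      have j2 := mul_le_mul_of_nonneg_left i4 hm1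
      linarith
    · have e : ∀ G : Finset α, (if E j ⊆ G then Kc U p E pi (a :: L) R N G H else 0) =
          (1 - pi - epsc pi (qc U p E R N (E a))) *
            (if E j ⊆ G then Kc U p E pi L R (insert a N) G H else 0) +
          epsc pi (qc U p E R N (E a)) *
            (if E j ⊆ G then Kc U p E pi L R N G H else 0) := by
        intro G
        by_cases hG : E j ⊆ G
        · simp only [hG, if_true, Kc_cons_notMem U p E pi h]
        · simp [hG]
      simp only [e, Finset.sum_add_distrib, ← Finset.mul_sum]
      rw [List.toFinset_cons, bw_insert_ext' (p := pi) ha h]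
      by_cases hja : j = a
      · subst hja
        have z : ∑ G : Finset α, (if E j ⊆ G then Kc U p E pi L R (insert j N) G H else 0) = 0 := by
          apply Finset.sum_eq_zero
          intro G _
          split_ifs with hG
          · by_contra hc
            exact (Kc_supp U p E pi L R (insert j N) G H hc).1.2 j (Finset.mem_insert_self _ _) hG
          · rfl
        have i2 := Kc_upper U E hp0 hp1 hpi0 hpi1 hE (E j) (hE j) L hL.2 R N H hR
        set ps := p ^ (E j \ (R ∪ Gof E H)).card with hps
        have hps0 : pi ≤ ps := hj.trans
          (pow_le_pow_of_le_one hp0.le hp1 (Finset.card_le_card Finset.sdiff_subset))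
        have hpspos : 0 < ps := lt_of_lt_of_le hpi0 hps0
        have hq : qc U p E R N (E j) ≤ ps := (qc_upper U E hp0 hp1 R N (E j) hR (hE j)).trans
          (pow_le_pow_of_le_one hp0.le hp1 (Finset.card_le_card
            (Finset.sdiff_subset_sdiff (Finset.Subset.refl _) Finset.subset_union_left)))
        have key : epsc pi (qc U p E R N (E j)) * ps ≤ ps - pi := by
          unfold epsc
          split_ifs with hc
          · have hq0 : 0 < qc U p E R N (E j) := lt_of_lt_of_le hpi0 hc
            have : pi ≤ pi / qc U p E R N (E j) * ps := by
              rw [div_mul_eq_mul_div, le_div_iff₀ hq0]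
              exact mul_le_mul_of_nonneg_left hq hpi0.le
            linarith
          · linarith
        rw [z, mul_zero, zero_add]
        have e2 : (ps - pi) / (1 - pi) * ((1 - pi) * bw L.toFinset pi H) =
            (ps - pi) * bw L.toFinset pi H := by field_simp
        rw [e2]
        calc _ ≤ epsc pi (qc U p E R N (E j)) * (ps * bw L.toFinset pi H) :=
              mul_le_mul_of_nonneg_left i2 he1
          _ = (epsc pi (qc U p E R N (E j)) * ps) * bw L.toFinset pi H := by ring
          _ ≤ _ := mul_le_mul_of_nonneg_right key (hbn _)
      · have hjL' : j ∈ L := by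
          rcases List.mem_cons.1 hjL with h1 | h1
          · exact absurd h1 hja
          · exact h1
        have i1 := ih hL.2 hjL' R (insert a N) H hR hjH
        have i2 := ih hL.2 hjL' R N H hR hjH
        have j1 := mul_le_mul_of_nonneg_left i1
          (by linarith : 0 ≤ 1 - pi - epsc pi (qc U p E R N (E a)))
        have j2 := mul_le_mul_of_nonneg_left i2 he1
        linarith

/-- The coupling succeeds whenever the final `F`-graph is good. -/
lemma Kc_first (hp0 : 0 < p) (hp1 : p ≤ 1) (hpi0 : 0 < pi) (hpi1 : pi < 1) (Good : Finset ι → Prop)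
    (hgood : ∀ (H' Hp N : Finset ι) (a : ι), Good H' → Hp ⊆ H' → a ∈ H' → a ∉ Hp → a ∉ N →
      Zf U p E (Gof E Hp) N ≠ 0 → pi ≤ qc U p E (Gof E Hp) N (E a))
    (L : List ι) : L.Nodup →
    ∀ (Hp : Finset ι) (N : Finset ι) (G : Finset α) (H : Finset ι),
      (∀ a ∈ L, a ∉ Hp ∧ a ∉ N) →
      Good (Hp ∪ H) → Kc U p E pi L (Gof E Hp) N G H ≠ 0 → ∀ i ∈ H, E i ⊆ G := by
  induction L with
  | nil =>
    intro _ Hp N G H _ _ hK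
    have := (Kc_supp U p E pi _ _ _ _ _ hK).2
    intro i hi
    exact absurd (this hi) (by simp)
  | cons a L ih =>
    intro hL Hp N G H hdisj hG hK
    rw [List.nodup_cons] at hL
    have hda := hdisj a List.mem_cons_self
    have hdL : ∀ b ∈ L, b ∉ Hp ∧ b ∉ N := fun b hb => hdisj b (List.mem_cons_of_mem _ hb)
    have hne : ∀ b ∈ L, b ≠ a := fun b hb hba => hL.1 (hba ▸ hb)
    by_cases h : a ∈ H
    · rw [Kc_cons_mem U p E pi h] at hK
      have hZ : Zf U p E (Gof E Hp) N ≠ 0 := by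
        intro hZ
        have hs := Zf_split U p E (Gof E Hp) N a
        have n1 := Zf_nonneg U E hp0.le hp1 (Gof E Hp ∪ E a) N
        have n2 := Zf_nonneg U E hp0.le hp1 (Gof E Hp) (insert a N)
        have z1 : Zf U p E (Gof E Hp ∪ E a) N = 0 := by linarith
        have z2 : Zf U p E (Gof E Hp) (insert a N) = 0 := by linarith
        have hnn := Kc_nonneg U E hp0 hp1 hpi0 hpi1 L
        have y : ∀ (R : Finset α) (N : Finset ι), Zf U p E R N = 0 →
            Kc U p E pi L R N G (H.erase a) = 0 := by
          intro R N hz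
          have h1 := Kc_margH U E hp0 hp1 hpi0 hpi1 L hL.2 R N (H.erase a)
          rw [tauc_eq, if_pos hz, zero_mul, Finset.sum_eq_zero_iff_of_nonneg] at h1
          · exact h1 G (Finset.mem_univ _)
          · intro G _; exact hnn _ _ _ _
        apply hK
        rw [y _ _ z1, y _ _ z2]; ring
      have hq := hgood (Hp ∪ H) Hp N a hG Finset.subset_union_left
        (Finset.mem_union_right _ h) hda.1 hda.2 hZ
      rw [min_eq_left hq, sub_self, zero_mul, add_zero] at hK
      have hK' : Kc U p E pi L (Gof E Hp ∪ E a) N G (H.erase a) ≠ 0 := by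
        intro h0; apply hK; rw [h0, mul_zero]
      have e1 : Gof E Hp ∪ E a = Gof E (insert a Hp) := by
        unfold Gof; rw [Finset.sup_insert, Finset.union_comm]; rfl
      rw [e1] at hK'
      have e2 : insert a Hp ∪ H.erase a = Hp ∪ H := by
        ext x
        simp only [Finset.mem_union, Finset.mem_insert, Finset.mem_erase]
        by_cases hx : x = a
        · subst hx; simp [h]
        · simp [hx]
      have := ih hL.2 (insert a Hp) N G (H.erase a)
        (fun b hb => ⟨by simp [hne b hb, (hdL b hb).1], (hdL b hb).2⟩) (by rw [e2]; exact hG) hK'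
      have hok := (Kc_supp U p E pi _ _ _ _ _ hK').1.1
      intro i hi
      by_cases hia : i = a
      · subst hia
        rw [← e1] at hok
        exact Finset.subset_union_right.trans hok
      · exact this i (Finset.mem_erase.2 ⟨hia, hi⟩)
    · rw [Kc_cons_notMem U p E pi h] at hK
      have : Kc U p E pi L (Gof E Hp) (insert a N) G H ≠ 0 ∨ Kc U p E pi L (Gof E Hp) N G H ≠ 0 := by
        by_contra hc
        push Not at hc
        apply hK
        rw [hc.1, hc.2]; ring
      rcases this with h1 | h1
      · exact ih hL.2 Hp (insert a N) G H
          (fun b hb => ⟨(hdL b hb).1, by simp [hne b hb, (hdL b hb).2]⟩) hG h1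
      · exact ih hL.2 Hp N G H hdL hG h1

end Coupling2

section Cover

lemma core_cover {κ : Type*} {r u : ℕ} (hu : 2 ≤ u) (F : Finset (Finset (Fin r)))
    (hFcard : ∀ e ∈ F, e.card = u) (h3 : ThreeConnected F)
    (S : Finset κ) (hS : S.Nonempty) (T : κ → Finset (Fin r)) (c : Finset (Fin r) → κ)
    (hc : ∀ e ∈ F, c e ∈ S ∧ e ⊆ T (c e)) (hsurj : ∀ h ∈ S, ∃ e ∈ F, c e = h)
    (hproper : ∀ h ∈ S, T h ≠ Finset.univ) :
    r + S.card < ∑ h ∈ S, (T h).card := by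
  obtain ⟨hr, h3⟩ := h3
  set m : Fin r → ℕ := fun x => (S.filter (fun h => x ∈ T h)).card with hm
  set B : Finset (Fin r) := Finset.univ.filter (fun x => 2 ≤ m x) with hB
  -- every vertex is in some edge
  have hvert : ∀ x : Fin r, ∃ e ∈ F, x ∈ e := by
    intro x
    obtain ⟨y, hy⟩ : ∃ y : Fin r, y ≠ x := by
      by_contra hcon
      push Not at hcon
      have : (Finset.univ : Finset (Fin r)).card ≤ 1 :=
        Finset.card_le_one.2 (fun a _ b _ => (hcon a).trans (hcon b).symm)
      simp at this; omega
    have := h3 ∅ (by simp) x y (by simp) (by simp)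
    rcases Relation.ReflTransGen.cases_head this with h | ⟨z, ⟨e, he, _, hxe, _⟩, _⟩
    · exact absurd h.symm hy
    · exact ⟨e, he, hxe⟩
  have hm1 : ∀ x, 1 ≤ m x := by
    intro x
    obtain ⟨e, he, hxe⟩ := hvert x
    exact Finset.card_pos.2 ⟨c e, Finset.mem_filter.2 ⟨(hc e he).1, (hc e he).2 hxe⟩⟩
  have ht2 : ∀ h ∈ S, u ≤ (T h).card := by
    intro h hh
    obtain ⟨e, he, hce⟩ := hsurj h hh
    rw [← hFcard e he]
    exact Finset.card_le_card (hce ▸ (hc e he).2)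
  have huniq : ∀ x h h', h ∈ S → h' ∈ S → x ∈ T h → x ∈ T h' → x ∉ B → h = h' := by
    intro x h h' hh hh' hx hx' hxB
    by_contra hne
    apply hxB
    rw [hB, Finset.mem_filter]
    refine ⟨Finset.mem_univ _, ?_⟩
    have : ({h, h'} : Finset κ) ⊆ S.filter (fun h => x ∈ T h) := by
      intro z hz
      rw [Finset.mem_insert, Finset.mem_singleton] at hz
      rcases hz with rfl | rfl
      · exact Finset.mem_filter.2 ⟨hh, hx⟩
      · exact Finset.mem_filter.2 ⟨hh', hx'⟩
    have h2 := Finset.card_le_card this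
    rwa [Finset.card_pair hne] at h2
  have hb : ∀ h ∈ S, 3 ≤ (T h ∩ B).card ∨ ((T h ∩ B).card = 2 ∧ (T h).card = 2) := by
    intro h hh
    by_cases hb3 : 3 ≤ (T h ∩ B).card
    · exact Or.inl hb3
    right
    have hconn := h3 (T h ∩ B) (by omega)
    have hsub : T h ⊆ T h ∩ B := by
      by_contra hcon
      obtain ⟨x, hx, hxB⟩ := Finset.not_subset.1 hcon
      obtain ⟨y, hy⟩ : ∃ y, y ∉ T h := by
        by_contra hall
        push Not at hall
        exact hproper h hh (Finset.eq_univ_iff_forall.2 hall)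
      have hpath := hconn x y hxB (fun h' => hy (Finset.mem_inter.1 h').1)
      have : ∀ z, Relation.ReflTransGen
          (fun a b => ∃ e ∈ F, Disjoint e (T h ∩ B) ∧ a ∈ e ∧ b ∈ e) x z →
          z ∈ T h ∧ z ∉ T h ∩ B := by
        intro z hz
        induction hz with
        | refl => exact ⟨hx, hxB⟩
        | tail _ hstep ih =>
          obtain ⟨e, he, hdis, ha, hb⟩ := hstep
          obtain ⟨ih1, ih2⟩ := ih
          have hh' : c e = h := by
            apply huniq _ _ _ (hc e he).1 hh ((hc e he).2 ha) ih1
            intro hB'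
            exact ih2 (Finset.mem_inter.2 ⟨ih1, hB'⟩)
          exact ⟨hh' ▸ (hc e he).2 hb, Finset.disjoint_left.1 hdis hb⟩
      exact hy (this y hpath).1
    have e1 : T h ∩ B = T h := Finset.Subset.antisymm Finset.inter_subset_left hsub
    have := ht2 h hh
    rw [e1] at hb3 ⊢
    omega
  -- two small pieces cannot cover a vertex
  have hsmall : ∀ x h h', h ∈ S → h' ∈ S → x ∈ T h → x ∈ T h' → (T h).card = 2 → (T h').card = 2 →
      (∀ h'' ∈ S, x ∈ T h'' → h'' = h ∨ h'' = h') → False := by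
    intro x h h' hh hh' hx hx' ht ht' hall
    set D := (T h).erase x ∪ (T h').erase x with hD
    have hDc : D.card ≤ 2 := by
      refine (Finset.card_union_le _ _).trans ?_
      rw [Finset.card_erase_of_mem hx, Finset.card_erase_of_mem hx', ht, ht']
    have hxD : x ∉ D := by simp [hD]
    obtain ⟨w, hw⟩ : ∃ w, w ∉ insert x D := by
      by_contra hcon
      push Not at hcon
      have h1 : insert x D = Finset.univ := Finset.eq_univ_iff_forall.2 hcon
      have h2 := Finset.card_insert_le x D
      rw [h1, Finset.card_univ, Fintype.card_fin] at h2
      omega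
    rw [Finset.mem_insert, not_or] at hw
    have hpath := h3 D hDc x w hxD hw.2
    rcases Relation.ReflTransGen.cases_head hpath with h0 | ⟨z, ⟨e, he, hdis, hxe, _⟩, _⟩
    · exact hw.1 h0.symm
    · have hee : ∃ k, (T k).card = 2 ∧ e ⊆ T k ∧ (T k).erase x ⊆ D ∧ x ∈ T k := by
        rcases hall (c e) (hc e he).1 ((hc e he).2 hxe) with h1 | h1
        · exact ⟨h, ht, h1 ▸ (hc e he).2, Finset.subset_union_left, hx⟩
        · exact ⟨h', ht', h1 ▸ (hc e he).2, Finset.subset_union_right, hx'⟩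
      obtain ⟨k, hk, hek, hkD, _⟩ := hee
      have heq : e = T k := Finset.eq_of_subset_of_card_le hek (by rw [hk, hFcard e he]; exact hu)
      have : ((T k).erase x).Nonempty := by
        rw [← Finset.card_pos, ← heq, Finset.card_erase_of_mem hxe, hFcard e he]; omega
      obtain ⟨y, hy⟩ := this
      exact Finset.disjoint_left.1 hdis (heq ▸ Finset.mem_of_mem_erase hy) (hkD hy)
  -- discharging
  have hbpos : ∀ h ∈ S, 2 ≤ (T h ∩ B).card := fun h hh => by rcases hb h hh with h1 | h1 <;> omega
  have hSsum : (S.card : ℝ) = ∑ x ∈ B, ∑ h ∈ S.filter (fun h => x ∈ T h), (1 : ℝ) / (T h ∩ B).card := by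
    have h1 : (S.card : ℝ) = ∑ h ∈ S, ∑ x ∈ T h ∩ B, (1 : ℝ) / (T h ∩ B).card := by
      rw [Finset.card_eq_sum_ones]
      push_cast
      apply Finset.sum_congr rfl
      intro h hh
      rw [Finset.sum_const, nsmul_eq_mul]
      have : ((T h ∩ B).card : ℝ) ≠ 0 := by
        have := hbpos h hh
        positivity
      field_simp
    rw [h1]
    apply Finset.sum_comm'
    intro h x
    simp only [Finset.mem_inter, Finset.mem_filter]
    tauto
  have hx : ∀ x ∈ B, ∑ h ∈ S.filter (fun h => x ∈ T h), (1 : ℝ) / (T h ∩ B).card < (m x : ℝ) - 1 := by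
    intro x hxB
    have hmx : 2 ≤ m x := (Finset.mem_filter.1 hxB).2
    have hhalf : ∀ h ∈ S.filter (fun h => x ∈ T h), (1 : ℝ) / (T h ∩ B).card ≤ 1 / 2 := by
      intro h hh
      apply one_div_le_one_div_of_le (by norm_num)
      exact_mod_cast hbpos h (Finset.mem_filter.1 hh).1
    rcases Nat.lt_or_ge 2 (m x) with h2 | h2
    · have := Finset.sum_le_card_nsmul _ _ _ hhalf
      refine lt_of_le_of_lt this ?_
      rw [nsmul_eq_mul]
      change (m x : ℝ) * (1 / 2) < m x - 1
      have : (3 : ℝ) ≤ m x := by exact_mod_cast h2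
      linarith
    · have hm2 : (S.filter (fun h => x ∈ T h)).card = 2 := le_antisymm h2 hmx
      have hm2' : (m x : ℝ) = 2 := by exact_mod_cast hm2
      obtain ⟨h, h', hne, hpair⟩ := Finset.card_eq_two.1 hm2
      have hhm : h ∈ S.filter (fun h => x ∈ T h) := by rw [hpair]; simp
      have hhm' : h' ∈ S.filter (fun h => x ∈ T h) := by rw [hpair]; simp
      have a1 := hhalf h hhm
      have a2 := hhalf h' hhm'
      rw [hpair, Finset.sum_pair hne, hm2']
      rw [Finset.mem_filter] at hhm hhm'
      have third : ∀ k, 3 ≤ (T k ∩ B).card → (1 : ℝ) / (T k ∩ B).card ≤ 1 / 3 := by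
        intro k hk
        apply one_div_le_one_div_of_le (by norm_num)
        exact_mod_cast hk
      rcases hb h hhm.1 with c1 | c1
      · have := third h c1; linarith
      · rcases hb h' hhm'.1 with c2 | c2
        · have := third h' c2; linarith
        · exfalso
          refine hsmall x h h' hhm.1 hhm'.1 hhm.2 hhm'.2 c1.2 c2.2 ?_
          intro k hk hxk
          have : k ∈ S.filter (fun h => x ∈ T h) := Finset.mem_filter.2 ⟨hk, hxk⟩
          rw [hpair] at this
          simpa using this
  have hBne : B.Nonempty := by
    obtain ⟨h, hh⟩ := hS
    have : (T h ∩ B).Nonempty := by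
      rw [← Finset.card_pos]; have := hbpos h hh; omega
    exact this.mono Finset.inter_subset_right
  have hlt : (S.card : ℝ) < ∑ x ∈ B, ((m x : ℝ) - 1) := by
    rw [hSsum]
    exact Finset.sum_lt_sum_of_nonempty hBne hx
  have hle : ∑ x ∈ B, ((m x : ℝ) - 1) ≤ ∑ x : Fin r, ((m x : ℝ) - 1) := by
    apply Finset.sum_le_sum_of_subset_of_nonneg (Finset.subset_univ _)
    intro x _ _
    have : (1 : ℝ) ≤ m x := by exact_mod_cast hm1 x
    linarith
  have hdc : ∑ h ∈ S, (T h).card = ∑ x : Fin r, m x := by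
    simp only [hm, Finset.card_eq_sum_ones]
    apply Finset.sum_comm'
    intro h x
    simp
  rw [hdc]
  have hfin : (S.card : ℝ) < (∑ x : Fin r, (m x : ℝ)) - r := by
    refine lt_of_lt_of_le hlt (hle.trans (le_of_eq ?_))
    rw [Finset.sum_sub_distrib]
    simp
  have : ((r + S.card : ℕ) : ℝ) < ((∑ x : Fin r, m x : ℕ) : ℝ) := by
    push_cast; linarith
  exact_mod_cast this

lemma IsFEdge.card_fst {r n : ℕ} {F : Finset (Finset (Fin r))} {h : FE n} (hh : IsFEdge F n h) :
    h.1.card = r := by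
  obtain ⟨φ, h1, _⟩ := hh
  rw [h1, Finset.card_map, Finset.card_univ, Fintype.card_fin]

lemma IsFEdge.card_snd {r n : ℕ} {F : Finset (Finset (Fin r))} {h : FE n} (hh : IsFEdge F n h) :
    h.2.card = F.card := by
  obtain ⟨φ, _, h2⟩ := hh
  rw [h2]
  exact Finset.card_image_of_injective _ (Finset.map_injective φ)

lemma IsFEdge.sub {r n : ℕ} {F : Finset (Finset (Fin r))} {h : FE n} (hh : IsFEdge F n h) :
    ∀ e ∈ h.2, e ⊆ h.1 := by
  obtain ⟨φ, h1, h2⟩ := hh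
  intro e he
  rw [h2, Finset.mem_image] at he
  obtain ⟨e', _, rfl⟩ := he
  rw [h1]
  exact Finset.map_subset_map.2 (Finset.subset_univ _)

lemma ThreeConnected.vert {r : ℕ} {F : Finset (Finset (Fin r))} (h3 : ThreeConnected F)
    (x : Fin r) : ∃ e ∈ F, x ∈ e := by
  obtain ⟨hr, h3⟩ := h3
  obtain ⟨y, hy⟩ : ∃ y : Fin r, y ≠ x := by
    by_contra hcon
    push Not at hcon
    have : (Finset.univ : Finset (Fin r)).card ≤ 1 :=
      Finset.card_le_one.2 (fun a _ b _ => (hcon a).trans (hcon b).symm)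
    simp at this; omega
  have := h3 ∅ (by simp) x y (by simp) (by simp)
  rcases Relation.ReflTransGen.cases_head this with h | ⟨z, ⟨e, he, _, hxe, _⟩, _⟩
  · exact absurd h.symm hy
  · exact ⟨e, he, hxe⟩

/-- An `F`-edge whose `u`-edges are covered by other `F`-edges creates an avoidable
configuration. -/
lemma cover_avoidable {u r n : ℕ} (hu : 2 ≤ u) (F : Finset (Finset (Fin r)))
    (hFcard : ∀ e ∈ F, e.card = u) (hF : Nice u F) (HH : Finset (FE n))
    (hHH : ∀ h ∈ HH, IsFEdge F n h) (i : FE n) (hi : IsFEdge F n i) (hiH : i ∉ HH)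
    (hcov : ∀ e ∈ i.2, ∃ h ∈ HH, e ∈ h.2) : HasAvoidable r HH := by
  obtain ⟨_, h3, hnice⟩ := hF
  have hr : 4 ≤ r := h3.1
  obtain ⟨φ, hi1, hi2⟩ := hi
  have hcov' : ∀ e ∈ F, ∃ h ∈ HH, e.map φ ∈ h.2 := by
    intro e he
    exact hcov _ (by rw [hi2]; exact Finset.mem_image_of_mem _ he)
  have hx0 : 0 < r := by omega
  obtain ⟨e0, he0, _⟩ := h3.vert ⟨0, hx0⟩
  obtain ⟨hh0, hhh0, _⟩ := hcov' e0 he0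
  have hch : ∀ e : Finset (Fin r), ∃ h : FE n, e ∈ F → h ∈ HH ∧ e.map φ ∈ h.2 := by
    intro e
    by_cases he : e ∈ F
    · obtain ⟨h, h1, h2⟩ := hcov' e he
      exact ⟨h, fun _ => ⟨h1, h2⟩⟩
    · exact ⟨hh0, fun h => absurd h he⟩
  choose c hc using hch
  set S := F.image c with hS
  have hSsub : S ⊆ HH := by
    intro h hh
    obtain ⟨e, he, rfl⟩ := Finset.mem_image.1 hh
    exact (hc e he).1
  have hSne : S.Nonempty := ⟨c e0, Finset.mem_image_of_mem _ he0⟩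
  set T : FE n → Finset (Fin r) := fun h => Finset.univ.filter (fun x => φ x ∈ h.1) with hT
  have hcT : ∀ e ∈ F, c e ∈ S ∧ e ⊆ T (c e) := by
    intro e he
    refine ⟨Finset.mem_image_of_mem _ he, ?_⟩
    intro x hx
    rw [hT, Finset.mem_filter]
    refine ⟨Finset.mem_univ _, ?_⟩
    exact (hHH _ (hc e he).1).sub _ (hc e he).2 (Finset.mem_map_of_mem φ hx)
  have hsurj : ∀ h ∈ S, ∃ e ∈ F, c e = h := by
    intro h hh
    obtain ⟨e, he, rfl⟩ := Finset.mem_image.1 hh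
    exact ⟨e, he, rfl⟩
  have hTu : ∀ h ∈ S, u ≤ (T h).card := by
    intro h hh
    obtain ⟨e, he, hce⟩ := hsurj h hh
    rw [← hFcard e he]
    exact Finset.card_le_card (hce ▸ (hcT e he).2)
  have hicard : i.2.card = F.card := by
    rw [hi2]; exact Finset.card_image_of_injective _ (Finset.map_injective φ)
  have hTr : ∀ h ∈ S, T h = Finset.univ → h.1 = i.1 := by
    intro h hh hTh
    symm
    apply Finset.eq_of_subset_of_card_le
    · rw [hi1]
      intro y hy
      obtain ⟨x, _, rfl⟩ := Finset.mem_map.1 hy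
      have : x ∈ T h := by rw [hTh]; exact Finset.mem_univ _
      exact (Finset.mem_filter.1 this).2
    · rw [(hHH h (hSsub hh)).card_fst, hi1, Finset.card_map, Finset.card_univ, Fintype.card_fin]
  have hmain : r + S.card < ∑ h ∈ S, (T h).card := by
    by_cases hproper : ∀ h ∈ S, T h ≠ Finset.univ
    · exact core_cover hu F hFcard h3 S hSne T c hcT hsurj hproper
    push Not at hproper
    obtain ⟨h0, hh0S, hT0⟩ := hproper
    have hsum : ∑ h ∈ S, (T h).card = r + ∑ h ∈ S.erase h0, (T h).card := by
      rw [← Finset.add_sum_erase S _ hh0S, hT0, Finset.card_univ, Fintype.card_fin]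
    have h01 := hTr h0 hh0S hT0
    have hScard : 2 ≤ S.card := by
      by_contra hcon
      have h1 : S.card = 1 := by
        have := hSne.card_pos; omega
      obtain ⟨k, hk⟩ := Finset.card_eq_one.1 h1
      have hk0 : k = h0 := by rw [hk] at hh0S; exact (Finset.mem_singleton.1 hh0S).symm
      have hsub : i.2 ⊆ h0.2 := by
        intro e he
        rw [hi2] at he
        obtain ⟨e', he', rfl⟩ := Finset.mem_image.1 he
        have h2 := (hc e' he').2
        have h3' : c e' ∈ S := (hcT e' he').1
        rw [hk, Finset.mem_singleton, hk0] at h3'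
        rwa [h3'] at h2
      have heq := Finset.eq_of_subset_of_card_le hsub
        (by rw [hicard, (hHH h0 (hSsub hh0S)).card_snd])
      apply hiH
      have : i = h0 := Prod.ext h01.symm heq
      rw [this]; exact hSsub hh0S
    have hlow : ∀ h ∈ S.erase h0, 2 ≤ (T h).card := fun h hh =>
      hu.trans (hTu h (Finset.mem_of_mem_erase hh))
    have herase := Finset.card_erase_of_mem hh0S
    rcases Nat.lt_or_ge 2 S.card with hS3 | hS2
    · have := Finset.card_nsmul_le_sum _ _ _ hlow
      rw [smul_eq_mul, herase] at this
      omega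
    have hS2 : S.card = 2 := le_antisymm hS2 hScard
    rw [hS2] at herase
    obtain ⟨h', hh'⟩ := Finset.card_eq_one.1 herase
    have hh'm : h' ∈ S.erase h0 := by rw [hh']; simp
    rw [hsum, hh', Finset.sum_singleton, hS2]
    have h2 := hlow h' hh'm
    rcases Nat.lt_or_ge 2 (T h').card with h3' | h3'
    · omega
    exfalso
    have ht2 : (T h').card = 2 := le_antisymm h3' h2
    have hu2 : u = 2 := by
      have := hTu h' (Finset.mem_of_mem_erase hh'm); omega
    have hnn : ¬ ∃ a b : Finset (Fin r), a.card = u ∧ a ∉ F ∧ b ∈ F ∧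
      EdgeIso (insert a (F.erase b)) F := by
      rcases hnice with h | h
      · omega
      · exact h.2
    apply hnn
    obtain ⟨ψ, hψ1, hψ2⟩ := hHH h0 (hSsub hh0S)
    -- the permutation
    have hrange : ∀ x, ∃ y, φ y = ψ x := by
      intro x
      have : ψ x ∈ i.1 := by rw [← h01, hψ1]; simp
      rw [hi1] at this
      obtain ⟨y, _, hy⟩ := Finset.mem_map.1 this
      exact ⟨y, hy⟩
    choose σ0 hσ0 using hrange
    have hσinj : Function.Injective σ0 := by
      intro a b hab
      apply ψ.injective
      rw [← hσ0, ← hσ0, hab]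
    set σ : Equiv.Perm (Fin r) := Equiv.ofBijective σ0 (Finite.injective_iff_bijective.1 hσinj) with hσ
    have hσφ : ∀ x, φ (σ x) = ψ x := fun x => hσ0 x
    set F' := F.image (fun e => e.image (fun x => σ x)) with hF'
    have hmapeq : ∀ e : Finset (Fin r), (e.image (fun x => σ x)).map φ = e.map ψ := by
      intro e
      ext y
      simp only [Finset.mem_map, Finset.mem_image]
      constructor
      · rintro ⟨_, ⟨x, hx, rfl⟩, rfl⟩; exact ⟨x, hx, (hσφ x).symm⟩
      · rintro ⟨x, hx, rfl⟩; exact ⟨_, ⟨x, hx, rfl⟩, hσφ x⟩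
    have hmem' : ∀ e, e.map φ ∈ h0.2 → e ∈ F' := by
      intro e he
      rw [hψ2] at he
      obtain ⟨e', he', heq⟩ := Finset.mem_image.1 he
      rw [← hmapeq] at heq
      rw [hF', Finset.mem_image]
      exact ⟨e', he', Finset.map_injective φ heq⟩
    have hmem'' : ∀ e ∈ F', e.map φ ∈ h0.2 := by
      intro e he
      rw [hF', Finset.mem_image] at he
      obtain ⟨e', he', rfl⟩ := he
      rw [hmapeq, hψ2]
      exact Finset.mem_image_of_mem _ he'
    have hcardF' : F'.card = F.card :=
      Finset.card_image_of_injective _ (Finset.image_injective σ.injective)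
    -- all edges of F except T h' are in F'
    have hFF' : ∀ e ∈ F, e ≠ T h' → e ∈ F' := by
      intro e he hne
      have hce := (hcT e he).1
      by_cases h : c e = h0
      · exact hmem' e (h ▸ (hc e he).2)
      · have h4 : c e ∈ S.erase h0 := Finset.mem_erase.2 ⟨h, hce⟩
        rw [hh', Finset.mem_singleton] at h4
        exact absurd (Finset.eq_of_subset_of_card_le (h4 ▸ (hcT e he).2)
          (by rw [ht2, hFcard e he, hu2])) hne
    have hnotsub : ¬ F ⊆ F' := by
      intro hsub
      have hsub2 : i.2 ⊆ h0.2 := by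
        intro e he
        rw [hi2] at he
        obtain ⟨e', he', rfl⟩ := Finset.mem_image.1 he
        exact hmem'' _ (hsub he')
      have heq := Finset.eq_of_subset_of_card_le hsub2
        (by rw [hicard, (hHH h0 (hSsub hh0S)).card_snd])
      apply hiH
      have : i = h0 := Prod.ext h01.symm heq
      rw [this]; exact hSsub hh0S
    obtain ⟨e1, he1F, he1F'⟩ := Finset.not_subset.1 hnotsub
    have he1T : e1 = T h' := by
      by_contra hne
      exact he1F' (hFF' e1 he1F hne)
    have hsubE : F.erase e1 ⊆ F' := by
      intro e he
      rw [Finset.mem_erase] at he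
      exact hFF' e he.2 (he1T ▸ he.1)
    have hnotsub' : ¬ F' ⊆ F := by
      intro h
      have := Finset.eq_of_subset_of_card_le h (by rw [hcardF'])
      exact hnotsub (by rw [this])
    obtain ⟨b, hbF', hbF⟩ := Finset.not_subset.1 hnotsub'
    have hF'eq : insert b (F.erase e1) = F' := by
      apply Finset.eq_of_subset_of_card_le
      · exact Finset.insert_subset hbF' hsubE
      · have hbne : b ∉ F.erase e1 := fun h => hbF (Finset.mem_of_mem_erase h)
        rw [Finset.card_insert_of_notMem hbne, Finset.card_erase_of_mem he1F, hcardF']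
        have : 0 < F.card := Finset.card_pos.2 ⟨e1, he1F⟩
        omega
    refine ⟨b, e1, ?_, hbF, he1F, ?_⟩
    · rw [hF', Finset.mem_image] at hbF'
      obtain ⟨e', he', rfl⟩ := hbF'
      rw [Finset.card_image_of_injective _ σ.injective, hFcard e' he']
    · rw [hF'eq]
      refine ⟨σ.symm, ?_⟩
      rw [hF', Finset.image_image]
      have : ((fun e : Finset (Fin r) => e.image (fun x => σ.symm x)) ∘
          (fun e : Finset (Fin r) => e.image (fun x => σ x))) = id := by
        funext e
        simp only [Function.comp, Finset.image_image, id]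
        ext y
        simp
      rw [this, Finset.image_id]
  refine ⟨S, hSsub, hSne, ?_, ?_, ?_⟩
  · -- connectivity
    intro a ha b hb
    obtain ⟨ea, hea, rfl⟩ := hsurj a ha
    obtain ⟨eb, heb, rfl⟩ := hsurj b hb
    obtain ⟨x, hx⟩ : ea.Nonempty := by rw [← Finset.card_pos, hFcard ea hea]; omega
    obtain ⟨y, hy⟩ : eb.Nonempty := by rw [← Finset.card_pos, hFcard eb heb]; omega
    have hstep : ∀ e ∈ F, ∀ e' ∈ F, ∀ z, z ∈ e → z ∈ e' →
        (fun x y : FE n => x ∈ S ∧ y ∈ S ∧ (x.1 ∩ y.1).Nonempty) (c e) (c e') := by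
      intro e he e' he' z hz hz'
      refine ⟨(hcT e he).1, (hcT e' he').1, φ z, ?_⟩
      rw [Finset.mem_inter]
      exact ⟨(Finset.mem_filter.1 ((hcT e he).2 hz)).2, (Finset.mem_filter.1 ((hcT e' he').2 hz')).2⟩
    have hpath := h3.2 ∅ (by simp) x y (by simp) (by simp)
    have : ∀ z, Relation.ReflTransGen (fun a b => ∃ e ∈ F, Disjoint e ∅ ∧ a ∈ e ∧ b ∈ e) x z →
        ∀ e ∈ F, z ∈ e → Relation.ReflTransGen
          (fun x y : FE n => x ∈ S ∧ y ∈ S ∧ (x.1 ∩ y.1).Nonempty) (c ea) (c e) := by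
      intro z hz
      induction hz with
      | refl => intro e he hxe; exact Relation.ReflTransGen.single (hstep ea hea e he x hx hxe)
      | tail _ hst ih =>
        obtain ⟨e1, he1, _, h1, h2⟩ := hst
        intro e he hze
        exact (ih e1 he1 h1).tail (hstep e1 he1 e he _ h2 hze)
    exact this y hpath eb heb hy
  · -- nullity
    have hsub : S.sup Prod.fst ⊆ i.1 ∪ S.biUnion (fun h => h.1 \ i.1) := by
      intro x hx
      rw [Finset.mem_sup] at hx
      obtain ⟨h, hh, hxh⟩ := hx
      by_cases hxi : x ∈ i.1
      · exact Finset.mem_union_left _ hxi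
      · exact Finset.mem_union_right _ (Finset.mem_biUnion.2 ⟨h, hh, Finset.mem_sdiff.2 ⟨hxh, hxi⟩⟩)
    have hcard : ∀ h ∈ S, (h.1 \ i.1).card + (T h).card = r := by
      intro h hh
      refine Eq.trans ?_ (hHH h (hSsub hh)).card_fst
      rw [← Finset.card_sdiff_add_card_inter h.1 i.1]
      congr 1
      rw [← Finset.card_map φ]
      congr 1
      ext y
      rw [hi1]
      simp only [Finset.mem_map, Finset.mem_inter, hT, Finset.mem_filter, Finset.mem_univ, true_and]
      constructor
      · rintro ⟨x, hx, rfl⟩; exact ⟨hx, x, rfl⟩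
      · rintro ⟨hy, x, rfl⟩; exact ⟨x, hy, rfl⟩
    have h1 := (Finset.card_le_card hsub).trans (Finset.card_union_le _ _)
    have h2 := Finset.card_biUnion_le (s := S) (t := fun h => h.1 \ i.1)
    have h3' : ∑ h ∈ S, (h.1 \ i.1).card + ∑ h ∈ S, (T h).card = S.card * r := by
      rw [← Finset.sum_add_distrib, Finset.sum_congr rfl hcard, Finset.sum_const, smul_eq_mul]
    have hicard1 : i.1.card = r := by rw [hi1]; simp
    have h4 : (r - 1) * S.card = S.card * r - S.card := by
      rw [Nat.sub_mul, one_mul, mul_comm]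
    rw [h4]
    rw [hicard1] at h1
    omega
  · have h1 : S.card ≤ F.card := Finset.card_image_le
    have h2 : F.card ≤ 2 ^ r := by
      have := Finset.card_le_univ F
      simpa using this
    have h4 : 2 ^ r ≤ 2 ^ (r + 1) := Nat.pow_le_pow_right (by norm_num) (by omega)
    omega

end Cover

section Count

/-- The shadow graph of an edge set. -/
def shG {r : ℕ} (A : Finset (Finset (Fin r))) : SimpleGraph (Fin r) where
  Adj x y := x ≠ y ∧ ∃ e ∈ A, x ∈ e ∧ y ∈ e
  symm := ⟨fun x y h => ⟨h.1.symm, by obtain ⟨e, he, h1, h2⟩ := h.2; exact ⟨e, he, h2, h1⟩⟩⟩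
  loopless := ⟨fun x h => h.1 rfl⟩

/-- Number of components of the shadow graph. -/
def kc {r : ℕ} (A : Finset (Finset (Fin r))) : ℕ := Fintype.card (shG A).ConnectedComponent

/-- One-step closed neighbourhood in the hypergraph of vertex sets. -/
def stepN {n : ℕ} (HH : Finset (FE n)) (S : Finset (Fin n)) : Finset (Fin n) :=
  S ∪ S.biUnion (fun v => (HH.filter (fun h => v ∈ h.1)).biUnion Prod.fst)

lemma stepN_sub {n : ℕ} (HH : Finset (FE n)) (S : Finset (Fin n)) : S ⊆ stepN HH S :=
  Finset.subset_union_left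

lemma stepN_mono {n : ℕ} (HH : Finset (FE n)) {S T : Finset (Fin n)} (h : S ⊆ T) :
    stepN HH S ⊆ stepN HH T :=
  Finset.union_subset_union h (Finset.biUnion_subset_biUnion_of_subset_left _ h)

lemma stepN_card {r n : ℕ} (HH : Finset (FE n)) (hHH : ∀ h ∈ HH, h.1.card = r) (D : ℕ)
    (hD : ∀ v, degFE HH v ≤ D) (S : Finset (Fin n)) : (stepN HH S).card ≤ S.card * (1 + D * r) := by
  refine (Finset.card_union_le _ _).trans ?_
  have : (S.biUnion (fun v => (HH.filter (fun h => v ∈ h.1)).biUnion Prod.fst)).card ≤ S.card * (D * r) := by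
    refine Finset.card_biUnion_le_card_mul _ _ _ (fun v _ => ?_)
    refine (Finset.card_biUnion_le_card_mul _ _ r (fun h hh => ?_)).trans ?_
    · exact (hHH h (Finset.mem_filter.1 hh).1).le
    · exact Nat.mul_le_mul_right _ (hD v)
  nlinarith

lemma iter_card {r n : ℕ} (HH : Finset (FE n)) (hHH : ∀ h ∈ HH, h.1.card = r) (D : ℕ)
    (hD : ∀ v, degFE HH v ≤ D) (S : Finset (Fin n)) (j : ℕ) :
    ((stepN HH)^[j] S).card ≤ S.card * (1 + D * r) ^ j := by
  induction j with
  | zero => simp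
  | succ j ih =>
    rw [Function.iterate_succ_apply']
    refine (stepN_card HH hHH D hD _).trans ?_
    rw [pow_succ, ← mul_assoc]
    exact Nat.mul_le_mul_right _ ih

lemma iter_mono_j {n : ℕ} (HH : Finset (FE n)) (S : Finset (Fin n)) {i j : ℕ} (h : i ≤ j) :
    (stepN HH)^[i] S ⊆ (stepN HH)^[j] S := by
  induction h with
  | refl => exact subset_rfl
  | step _ ih => rw [Function.iterate_succ_apply']; exact ih.trans (stepN_sub _ _)

lemma walk_iter {r n : ℕ} (HH : Finset (FE n)) (A : Finset (Finset (Fin r))) (φ : Fin r → Fin n)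
    (hφ : ∀ e ∈ A, ∃ h ∈ HH, ∀ x ∈ e, φ x ∈ h.1) {x y : Fin r} (w : (shG A).Walk x y)
    (S : Finset (Fin n)) (hS : φ x ∈ S) : φ y ∈ (stepN HH)^[w.length] S := by
  induction w generalizing S with
  | nil => simpa using hS
  | cons hadj w ih =>
    rw [SimpleGraph.Walk.length_cons, Function.iterate_succ_apply]
    apply ih
    obtain ⟨_, e, he, hx, hy⟩ := hadj
    obtain ⟨h, hh, hsub⟩ := hφ e he
    refine Finset.mem_union_right _ (Finset.mem_biUnion.2 ⟨_, hS, Finset.mem_biUnion.2 ⟨h, ?_, hsub _ hy⟩⟩)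
    exact Finset.mem_filter.2 ⟨hh, hsub _ hx⟩

lemma reach_iter {r n : ℕ} (HH : Finset (FE n)) (A : Finset (Finset (Fin r))) (φ : Fin r → Fin n)
    (hφ : ∀ e ∈ A, ∃ h ∈ HH, ∀ x ∈ e, φ x ∈ h.1) {x y : Fin r} (w : (shG A).Reachable x y)
    (S : Finset (Fin n)) (hS : φ x ∈ S) : φ y ∈ (stepN HH)^[r] S := by
  obtain ⟨w, hw⟩ := w.exists_isPath
  have := hw.length_lt
  rw [Fintype.card_fin] at this
  exact iter_mono_j HH S this.le (walk_iter HH A φ hφ w S hS)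

lemma count_phi {r n : ℕ} (HH : Finset (FE n)) (hHH : ∀ h ∈ HH, h.1.card = r) (D : ℕ)
    (hD : ∀ v, degFE HH v ≤ D) (A : Finset (Finset (Fin r))) (V0 : Finset (Fin n)) (hV0 : V0.card = r) :
    (Finset.univ.filter (fun φ : Fin r → Fin n =>
      (∀ e ∈ A, ∃ h ∈ HH, ∀ x ∈ e, φ x ∈ h.1) ∧ ∃ x, φ x ∈ V0)).card
      ≤ kc A * (r * (1 + D * r) ^ r * n ^ (kc A - 1) * ((1 + D * r) ^ r) ^ r) := by
  set CC := (shG A).ConnectedComponent with hCC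
  set B := (1 + D * r) ^ r with hB
  set Psi : CC → Finset (CC → Fin n) := fun c0 =>
    Fintype.piFinset (fun c => if c = c0 then (stepN HH)^[r] V0 else Finset.univ) with hPsi
  set big : Finset (Fin r → Fin n) := (Finset.univ : Finset CC).biUnion (fun c0 => (Psi c0).biUnion
    (fun ψ => Fintype.piFinset (fun x => (stepN HH)^[r] {ψ ((shG A).connectedComponentMk x)}))) with hbig
  have hsub : (Finset.univ.filter (fun φ : Fin r → Fin n =>
      (∀ e ∈ A, ∃ h ∈ HH, ∀ x ∈ e, φ x ∈ h.1) ∧ ∃ x, φ x ∈ V0)) ⊆ big := by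
    intro φ hφ
    obtain ⟨hφ, x0, hx0⟩ := (Finset.mem_filter.1 hφ).2
    have hout : ∀ x, (shG A).Reachable x ((shG A).connectedComponentMk x).out := fun x => by
      apply SimpleGraph.ConnectedComponent.exact
      exact (Quot.out_eq _).symm
    refine Finset.mem_biUnion.2 ⟨(shG A).connectedComponentMk x0, Finset.mem_univ _,
      Finset.mem_biUnion.2 ⟨fun c => φ c.out, ?_, ?_⟩⟩
    · rw [hPsi, Fintype.mem_piFinset]
      intro c
      split_ifs with hc
      · subst hc
        exact reach_iter HH A φ hφ (hout x0) V0 hx0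
      · exact Finset.mem_univ _
    · rw [Fintype.mem_piFinset]
      intro x
      exact reach_iter HH A φ hφ (hout x).symm _ (Finset.mem_singleton_self _)
  refine (Finset.card_le_card hsub).trans ?_
  have h1 : ∀ c0, (Psi c0).card ≤ r * B * n ^ (kc A - 1) := by
    intro c0
    rw [hPsi, Fintype.card_piFinset, ← Finset.mul_prod_erase _ _ (Finset.mem_univ c0)]
    rw [if_pos rfl]
    refine Nat.mul_le_mul ?_ ?_
    · rw [← hV0]; rw [hB]; 
      have := iter_card HH hHH D hD V0 r
      rwa [hV0] at this ⊢
    · rw [Finset.prod_congr rfl (g := fun _ => n)]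
      · rw [Finset.prod_const, Finset.card_erase_of_mem (Finset.mem_univ _)]; rfl
      · intro c hc
        rw [if_neg (Finset.ne_of_mem_erase hc)]; simp
  have h2 : ∀ ψ : CC → Fin n, (Fintype.piFinset (fun x => (stepN HH)^[r] {ψ ((shG A).connectedComponentMk x)})).card ≤ B ^ r := by
    intro ψ
    rw [Fintype.card_piFinset]
    refine (Finset.prod_le_pow_card _ _ B (fun x _ => ?_)).trans (by simp)
    have := iter_card HH hHH D hD {ψ ((shG A).connectedComponentMk x)} r
    simpa using this
  refine (Finset.card_biUnion_le_card_mul _ _ (r * B * n ^ (kc A - 1) * B ^ r) (fun c0 _ => ?_)).trans ?_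
  · refine (Finset.card_biUnion_le_card_mul _ _ (B ^ r) (fun ψ _ => h2 ψ)).trans ?_
    exact Nat.mul_le_mul_right _ (h1 c0)
  · rfl

lemma balance {u r : ℕ} (hu : 2 ≤ u) (F : Finset (Finset (Fin r))) (hFcard : ∀ e ∈ F, e.card = u)
    (hb : StrictlyOneBalanced F) (A : Finset (Finset (Fin r))) (hA : A ⊆ F) (hne : A.Nonempty)
    (hAF : A ≠ F) : ∃ m, m + kc A = r ∧ A.card * (r - 1) < F.card * m := by
  set W : (shG A).ConnectedComponent → Finset (Fin r) := fun c =>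
    Finset.univ.filter (fun x => (shG A).connectedComponentMk x = c) with hW
  set AW : (shG A).ConnectedComponent → Finset (Finset (Fin r)) := fun c =>
    A.filter (fun e => e ⊆ W c) with hAW
  have hsumW : ∑ c, (W c).card = r := by
    have := Finset.card_eq_sum_card_fiberwise (s := (Finset.univ : Finset (Fin r)))
      (t := (Finset.univ : Finset (shG A).ConnectedComponent)) (f := (shG A).connectedComponentMk)
      (fun x _ => Finset.mem_univ _)
    simpa using this.symm
  have hWpos : ∀ c, 1 ≤ (W c).card := by
    intro c
    refine Finset.card_pos.2 ⟨c.out, Finset.mem_filter.2 ⟨Finset.mem_univ _, Quot.out_eq _⟩⟩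
  have hcov : ∀ e ∈ A, ∃ c, e ∈ AW c := by
    intro e he
    have hc : 0 < e.card := by rw [hFcard e (hA he)]; omega
    obtain ⟨x, hx⟩ := Finset.card_pos.1 hc
    refine ⟨(shG A).connectedComponentMk x, Finset.mem_filter.2 ⟨he, fun y hy => Finset.mem_filter.2 ⟨Finset.mem_univ _, ?_⟩⟩⟩
    apply SimpleGraph.ConnectedComponent.sound
    by_cases hxy : y = x
    · rw [hxy]
    · exact SimpleGraph.Adj.reachable ⟨hxy, e, he, hy, hx⟩
  have hcardA : A.card ≤ ∑ c, (AW c).card := by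
    refine (Finset.card_le_card ?_).trans Finset.card_biUnion_le
    intro e he
    obtain ⟨c, hc⟩ := hcov e he
    exact Finset.mem_biUnion.2 ⟨c, Finset.mem_univ _, hc⟩
  have hstr : ∀ c, 1 < (W c).card → (AW c).card * (r - 1) < F.card * ((W c).card - 1) := by
    intro c hc
    refine hb (W c) (AW c) ((Finset.filter_subset _ _).trans hA) (fun e he => (Finset.mem_filter.1 he).2) hc ?_
    rintro ⟨_, h2⟩
    exact hAF (le_antisymm hA (h2 ▸ Finset.filter_subset _ _))
  have hle : ∀ c, (AW c).card * (r - 1) ≤ F.card * ((W c).card - 1) := by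
    intro c
    rcases (hWpos c).lt_or_eq with h | h
    · exact (hstr c h).le
    · have : AW c = ∅ := by
        rw [Finset.eq_empty_iff_forall_notMem]
        intro e he
        have h1 := Finset.card_le_card (Finset.mem_filter.1 he).2
        rw [hFcard e (hA (Finset.mem_filter.1 he).1)] at h1
        omega
      rw [this]; simp
  refine ⟨∑ c, ((W c).card - 1), ?_, ?_⟩
  · have : ∑ c, ((W c).card - 1) + ∑ c : (shG A).ConnectedComponent, 1 = r := by
      rw [← Finset.sum_add_distrib]
      refine Eq.trans ?_ hsumW
      exact Finset.sum_congr rfl (fun c _ => Nat.sub_add_cancel (hWpos c))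
    simpa [kc] using this
  · obtain ⟨e, he⟩ := hne
    obtain ⟨c, hc⟩ := hcov e he
    have h1 := Finset.card_le_card (Finset.mem_filter.1 hc).2
    rw [hFcard e (hA he)] at h1
    calc A.card * (r - 1) ≤ (∑ c, (AW c).card) * (r - 1) := Nat.mul_le_mul_right _ hcardA
      _ = ∑ c, (AW c).card * (r - 1) := Finset.sum_mul _ _ _
      _ < ∑ c, F.card * ((W c).card - 1) := Finset.sum_lt_sum (fun c _ => hle c) ⟨c, Finset.mem_univ _, hstr c (by omega)⟩
      _ = _ := (Finset.mul_sum _ _ _).symm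

lemma Qbound {u r n : ℕ} (hu : 2 ≤ u) (F : Finset (Finset (Fin r))) (hFcard : ∀ e ∈ F, e.card = u)
    (hF : Nice u F) (HH : Finset (FE n)) (hHH : ∀ h ∈ HH, IsFEdge F n h) (D : ℕ)
    (hD : ∀ v, degFE HH v ≤ D) (hav : ¬ HasAvoidable r HH) (h : FE n) (hh : h ∈ HH)
    (C : Finset (Finset (Fin n))) (hC : ∀ e, e ∈ C ↔ ∃ h' ∈ HH, e ∈ h'.2)
    (p : ℝ) (hp0 : 0 ≤ p) (y : ℝ) (hy0 : 0 ≤ y)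
    (hy : ∀ A ⊆ F, A.Nonempty → A ≠ F → p ^ (F.card - A.card) * (n : ℝ) ^ (kc A - 1) ≤ y)
    (N : Finset (FE n)) (hN : ∀ i ∈ N, IsFEdge F n i ∧ i ∉ HH ∧ ∃ e ∈ i.2, e ∈ h.2) :
    ∑ i ∈ N, p ^ (i.2 \ C).card ≤
      2 ^ F.card * ((r * (r * (1 + D * r) ^ r * ((1 + D * r) ^ r) ^ r) : ℕ) * y) := by
  have : Nonempty (Fin r ↪ Fin n) := ⟨(hHH h hh).choose⟩
  choose! φ hφ1 hφ2 using fun i (hi : i ∈ N) => (hN i hi).1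
  set aset : FE n → Finset (Finset (Fin r)) := fun i => F.filter (fun e => e.map (φ i) ∈ C) with haset
  have hcard : ∀ i ∈ N, (i.2 \ C).card = F.card - (aset i).card := by
    intro i hi
    have h1 : i.2 \ C = (F \ aset i).image (fun e => e.map (φ i)) := by
      rw [hφ2 i hi]
      ext e
      simp only [Finset.mem_sdiff, Finset.mem_image, haset, Finset.mem_filter]
      constructor
      · rintro ⟨⟨e, he, rfl⟩, h2⟩; exact ⟨e, ⟨he, fun h => h2 h.2⟩, rfl⟩
      · rintro ⟨e, ⟨he, h2⟩, rfl⟩; exact ⟨⟨e, he, rfl⟩, fun h => h2 ⟨he, h⟩⟩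
    rw [h1, Finset.card_image_of_injective _ (Finset.map_injective _),
      Finset.card_sdiff_of_subset (Finset.filter_subset _ _)]
  rw [Finset.sum_congr rfl (fun i hi => by rw [hcard i hi])]
  rw [← Finset.sum_fiberwise_of_maps_to (t := F.powerset) (g := aset)
    (fun i _ => Finset.mem_powerset.2 (Finset.filter_subset _ _))]
  have hmain : ∀ A ∈ F.powerset, ∑ i ∈ N with aset i = A, p ^ (F.card - (aset i).card) ≤
      ((r * (r * (1 + D * r) ^ r * ((1 + D * r) ^ r) ^ r) : ℕ) * y) := by
    intro A hA
    rw [Finset.mem_powerset] at hA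
    rcases (N.filter (fun i => aset i = A)).eq_empty_or_nonempty with he | ⟨i, hi⟩
    · rw [he, Finset.sum_empty]; positivity
    obtain ⟨hiN, hiA⟩ := Finset.mem_filter.1 hi
    obtain ⟨hiF, hiHH, e, hei, heh⟩ := hN i hiN
    have hAne : A.Nonempty := by
      rw [hφ2 i hiN] at hei
      obtain ⟨e', he', rfl⟩ := Finset.mem_image.1 hei
      rw [← hiA]
      exact ⟨e', Finset.mem_filter.2 ⟨he', (hC _).2 ⟨h, hh, heh⟩⟩⟩
    have hAF : A ≠ F := by
      intro hAF
      apply hav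
      refine cover_avoidable hu F hFcard hF HH hHH i hiF hiHH (fun e he => ?_)
      rw [hφ2 i hiN] at he
      obtain ⟨e', he', rfl⟩ := Finset.mem_image.1 he
      rw [← hAF, ← hiA] at he'
      exact (hC _).1 (Finset.mem_filter.1 he').2
    have hyA := hy A hA hAne hAF
    have hcnt := count_phi HH (fun h hh => (hHH h hh).card_fst) D hD A h.1 (hHH h hh).card_fst
    have hinj : (N.filter (fun i => aset i = A)).card ≤ (Finset.univ.filter (fun φ : Fin r → Fin n =>
      (∀ e ∈ A, ∃ h ∈ HH, ∀ x ∈ e, φ x ∈ h.1) ∧ ∃ x, φ x ∈ h.1)).card := by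
      refine Finset.card_le_card_of_injOn (fun i => ⇑(φ i)) ?_ ?_
      · intro i hi
        obtain ⟨hiN, hiA⟩ := Finset.mem_filter.1 (Finset.mem_coe.1 hi)
        refine Finset.mem_coe.2 (Finset.mem_filter.2 ⟨Finset.mem_univ _, ?_, ?_⟩)
        · intro e he
          rw [← hiA] at he
          obtain ⟨h', hh', he'⟩ := (hC _).1 (Finset.mem_filter.1 he).2
          exact ⟨h', hh', fun x hx => (hHH h' hh').sub _ he' (Finset.mem_map_of_mem _ hx)⟩
        · obtain ⟨_, _, e, hei, heh⟩ := hN i hiN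
          rw [hφ2 i hiN] at hei
          obtain ⟨e', he', rfl⟩ := Finset.mem_image.1 hei
          have hc : 0 < e'.card := by rw [hFcard e' he']; omega
          obtain ⟨x, hx⟩ := Finset.card_pos.1 hc
          exact ⟨x, (hHH h hh).sub _ heh (Finset.mem_map_of_mem _ hx)⟩
      · intro i hi j hj hij
        have hij' : φ i = φ j := DFunLike.coe_injective hij
        have hi := (Finset.mem_filter.1 (Finset.mem_coe.1 hi)).1
        have hj := (Finset.mem_filter.1 (Finset.mem_coe.1 hj)).1
        exact Prod.ext (by rw [hφ1 i hi, hφ1 j hj, hij']) (by rw [hφ2 i hi, hφ2 j hj, hij'])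
    have hkc : kc A ≤ r := by
      obtain ⟨m, hm, _⟩ := balance hu F hFcard hF.1 A hA hAne hAF
      omega
    calc ∑ i ∈ N with aset i = A, p ^ (F.card - (aset i).card)
        = ∑ i ∈ N with aset i = A, p ^ (F.card - A.card) :=
          Finset.sum_congr rfl (fun i hi => by rw [(Finset.mem_filter.1 hi).2])
      _ = (N.filter (fun i => aset i = A)).card * p ^ (F.card - A.card) := by
          rw [Finset.sum_const, nsmul_eq_mul]
      _ ≤ ((r * (r * (1 + D * r) ^ r * n ^ (kc A - 1) * ((1 + D * r) ^ r) ^ r) : ℕ) : ℝ) * p ^ (F.card - A.card) := by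
          refine mul_le_mul_of_nonneg_right ?_ (by positivity)
          exact_mod_cast (hinj.trans hcnt).trans (Nat.mul_le_mul_right _ hkc)
      _ = ((r * (r * (1 + D * r) ^ r * ((1 + D * r) ^ r) ^ r) : ℕ) : ℝ) * (p ^ (F.card - A.card) * (n : ℝ) ^ (kc A - 1)) := by
          push_cast; ring
      _ ≤ _ := mul_le_mul_of_nonneg_left hyA (by positivity)
  refine (Finset.sum_le_sum hmain).trans ?_
  rw [Finset.sum_const, Finset.card_powerset, nsmul_eq_mul]
  push_cast
  exact le_rfl

/-- Exponent computation. -/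
lemma yBound {u r : ℕ} (hu : 2 ≤ u) (F : Finset (Finset (Fin r))) (hFcard : ∀ e ∈ F, e.card = u)
    (hb : StrictlyOneBalanced F) (n : ℕ) (hn : 1 ≤ n) (p : ℝ) (hp0 : 0 ≤ p) (η : ℝ) (hη : 0 ≤ η)
    (hs : 0 < F.card) (hp : p ≤ (n : ℝ) ^ ((-((r : ℝ) - 1) + η) / F.card)) (hr : 1 ≤ r)
    (A : Finset (Finset (Fin r))) (hA : A ⊆ F) (hne : A.Nonempty) (hAF : A ≠ F) :
    p ^ (F.card - A.card) * (n : ℝ) ^ (kc A - 1) ≤ (n : ℝ) ^ (-1 / (F.card : ℝ) + η) := by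
  obtain ⟨m, hm, hlt⟩ := balance hu F hFcard hb A hA hne hAF
  have hkpos : 1 ≤ kc A := by
    have : Nonempty (shG A).ConnectedComponent := ⟨(shG A).connectedComponentMk ⟨0, hr⟩⟩
    exact Fintype.card_pos
  have hn' : (1 : ℝ) ≤ n := by exact_mod_cast hn
  have hAc := Finset.card_le_card hA
  have hs' : (0 : ℝ) < F.card := by exact_mod_cast hs
  calc p ^ (F.card - A.card) * (n : ℝ) ^ (kc A - 1)
      ≤ ((n : ℝ) ^ ((-((r : ℝ) - 1) + η) / F.card)) ^ (F.card - A.card) * (n : ℝ) ^ (kc A - 1) := by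
        gcongr
    _ = (n : ℝ) ^ ((-((r : ℝ) - 1) + η) / F.card * ((F.card : ℝ) - A.card) + ((kc A : ℝ) - 1)) := by
        rw [Real.rpow_add (by linarith), ← Real.rpow_natCast, ← Real.rpow_natCast, ← Real.rpow_mul (by linarith)]
        rw [Nat.cast_sub hAc, Nat.cast_sub hkpos]; norm_num
    _ ≤ _ := by
        apply Real.rpow_le_rpow_of_exponent_le hn'
        have h1 : (A.card : ℝ) * ((r : ℝ) - 1) + 1 ≤ F.card * m := by
          have : A.card * (r - 1) + 1 ≤ F.card * m := hlt
          have h2 : ((A.card * (r - 1) + 1 : ℕ) : ℝ) ≤ ((F.card * m : ℕ) : ℝ) := by exact_mod_cast this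
          push_cast [Nat.cast_sub hr] at h2
          exact h2
        have h2 : (m : ℝ) + kc A = r := by exact_mod_cast hm
        have h3 : (0 : ℝ) ≤ A.card := by positivity
        have hk : (kc A : ℝ) = r - m := by linarith
        rw [hk]
        have e1 : (-((r : ℝ) - 1) + η) / F.card * ((F.card : ℝ) - A.card) + ((r : ℝ) - m - 1)
            = (A.card * ((r : ℝ) - 1) - F.card * m) / F.card + η - η * A.card / F.card := by
          field_simp; ring
        rw [e1]
        have h4 : (A.card * ((r : ℝ) - 1) - F.card * m) / F.card ≤ -1 / F.card := by
          apply div_le_div_of_nonneg_right _ hs'.le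
          linarith
        have h5 : 0 ≤ η * A.card / F.card := by positivity
        linarith

end Count

section Bad

/-- Edge set of an `F`-edge (empty for junk). -/
def EE {r : ℕ} (F : Finset (Finset (Fin r))) (n : ℕ) (h : FE n) : Finset (Finset (Fin n)) :=
  if IsFEdge F n h then h.2 else ∅

lemma EE_of {r n : ℕ} {F : Finset (Finset (Fin r))} {h : FE n} (hh : IsFEdge F n h) :
    EE F n h = h.2 := if_pos hh

lemma EE_sub {u r n : ℕ} (F : Finset (Finset (Fin r))) (hFcard : ∀ e ∈ F, e.card = u) (h : FE n) :
    EE F n h ⊆ allUEdges u n := by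
  unfold EE
  split_ifs with hh
  · obtain ⟨φ, _, h2⟩ := hh
    rw [h2]
    intro e he
    obtain ⟨e', he', rfl⟩ := Finset.mem_image.1 he
    refine Finset.mem_filter.2 ⟨Finset.mem_univ _, ?_⟩
    rw [Finset.card_map, hFcard e' he']
  · simp

lemma HasAvoidable.mono {r n : ℕ} {H H' : Finset (FE n)} (h : H ⊆ H') (ha : HasAvoidable r H) :
    HasAvoidable r H' := by
  obtain ⟨S, hS, h2⟩ := ha
  exact ⟨S, hS.trans h, h2⟩

lemma mem_Gof {α ι : Type*} [DecidableEq α] {E : ι → Finset α} {H : Finset ι} {e : α} :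
    e ∈ Gof E H ↔ ∃ h ∈ H, e ∈ E h := by
  unfold Gof; rw [Finset.mem_sup]

/-- Good `F`-graphs. -/
def GoodH {r : ℕ} (F : Finset (Finset (Fin r))) (n D : ℕ) (H : Finset (FE n)) : Prop :=
  (∀ h ∈ H, IsFEdge F n h) ∧ ¬ HasAvoidable r H ∧ ∀ v, degFE H v ≤ D

lemma hgood_lemma {u r n : ℕ} (hu : 2 ≤ u) (F : Finset (Finset (Fin r))) (hFcard : ∀ e ∈ F, e.card = u)
    (hF : Nice u F) (D : ℕ) (p pi ε y : ℝ) (hp0 : 0 < p) (hp1 : p ≤ 1) (hε : ε ≤ 1) (hy0 : 0 ≤ y)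
    (hy : ∀ A ⊆ F, A.Nonempty → A ≠ F → p ^ (F.card - A.card) * (n : ℝ) ^ (kc A - 1) ≤ y)
    (hQ : 2 ^ F.card * ((r * (r * (1 + D * r) ^ r * ((1 + D * r) ^ r) ^ r) : ℕ) * y) ≤ ε)
    (hpi : pi ≤ p ^ F.card * (1 - ε)) (H' Hp N : Finset (FE n)) (a : FE n)
    (hG : GoodH F n D H') (hsub : Hp ⊆ H') (ha : a ∈ H') (haN : a ∉ N)
    (hZ : Zf (allUEdges u n) p (EE F n) (Gof (EE F n) Hp) N ≠ 0) :
    pi ≤ qc (allUEdges u n) p (EE F n) (Gof (EE F n) Hp) N (EE F n a) := by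
  obtain ⟨hG1, hG2, hG3⟩ := hG
  set E := EE F n with hE
  set R := Gof E Hp with hR
  have haF := hG1 a ha
  have hEa : E a = a.2 := EE_of haF
  have hRU : R ⊆ allUEdges u n := by
    intro e he
    obtain ⟨h, _, h2⟩ := mem_Gof.1 he
    exact EE_sub F hFcard h h2
  set N1 := N.filter (fun i => ¬ (E i ∩ E a ⊆ R)) with hN1
  have hins : insert a Hp ⊆ H' := Finset.insert_subset ha hsub
  have hN1p : ∀ i ∈ N1, IsFEdge F n i ∧ i ∉ insert a Hp ∧ ∃ e ∈ i.2, e ∈ a.2 := by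
    intro i hi
    obtain ⟨hiN, hi2⟩ := Finset.mem_filter.1 hi
    have hiF : IsFEdge F n i := by
      by_contra hcon
      apply hi2
      rw [hE]; unfold EE; rw [if_neg hcon]; simp
    have hEi : E i = i.2 := EE_of hiF
    refine ⟨hiF, ?_, ?_⟩
    · intro hmem
      rcases Finset.mem_insert.1 hmem with rfl | hmem
      · exact haN hiN
      · apply hi2
        intro e he
        exact mem_Gof.2 ⟨i, hmem, (Finset.mem_inter.1 he).1⟩
    · obtain ⟨e, he, _⟩ := Finset.not_subset.1 hi2
      rw [hEi, hEa] at he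
      exact ⟨e, (Finset.mem_inter.1 he).1, (Finset.mem_inter.1 he).2⟩
  have hQ' : ∑ i ∈ N1, p ^ ((E i) \ (R ∪ E a)).card ≤ ε := by
    rw [Finset.sum_congr rfl (fun i hi => by rw [show E i = i.2 from EE_of (hN1p i hi).1])]
    refine (Qbound hu F hFcard hF (insert a Hp) (fun h hh => hG1 h (hins hh)) D ?_ ?_ a
      (Finset.mem_insert_self _ _) (R ∪ E a) ?_ p hp0.le y hy0 hy N1 hN1p).trans hQ
    · intro v
      refine le_trans (Finset.card_le_card ?_) (hG3 v)
      exact Finset.filter_subset_filter _ hins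
    · exact fun h => hG2 (h.mono hins)
    · intro e
      rw [Finset.mem_union, mem_Gof, hEa]
      constructor
      · rintro (⟨h, hh, he⟩ | he)
        · refine ⟨h, Finset.mem_insert_of_mem hh, ?_⟩
          rwa [show E h = h.2 from EE_of (hG1 h (hsub hh))] at he
        · exact ⟨a, Finset.mem_insert_self _ _, he⟩
      · rintro ⟨h, hh, he⟩
        rcases Finset.mem_insert.1 hh with rfl | hh
        · exact Or.inr he
        · refine Or.inl ⟨h, hh, ?_⟩
          rwa [show E h = h.2 from EE_of (hG1 h (hsub hh))]
  have hlow := Zf_lower (allUEdges u n) E hp1 hp0 R (E a) N hRU (EE_sub F hFcard a)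
    (EE_sub F hFcard) ε hQ' hε
  have hZpos : 0 < Zf (allUEdges u n) p E R N :=
    lt_of_le_of_ne (Zf_nonneg (allUEdges u n) E hp0.le hp1 R N) (Ne.symm hZ)
  unfold qc
  rw [le_div_iff₀ hZpos]
  refine le_trans ?_ hlow
  refine mul_le_mul_of_nonneg_right ?_ hZpos.le
  refine hpi.trans ?_
  refine mul_le_mul_of_nonneg_right ?_ (by linarith)
  apply pow_le_pow_of_le_one hp0.le hp1
  refine (Finset.card_le_card Finset.sdiff_subset).trans ?_
  rw [hEa, haF.card_snd]

/-- Union bound. -/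
lemma union_bound {ι : Type*} [DecidableEq ι] [Fintype ι] (U : Finset ι) (pi : ℝ) (h0 : 0 ≤ pi) (h1 : pi ≤ 1)
    (P : Finset ι → Prop) [DecidablePred P] (SS : Finset (Finset ι)) (hSS : ∀ S ∈ SS, S ⊆ U)
    (hP : ∀ H ⊆ U, P H → ∃ S ∈ SS, S ⊆ H) :
    ∑ H : Finset ι, (if P H then bw U pi H else 0) ≤ ∑ S ∈ SS, pi ^ S.card := by
  calc ∑ H : Finset ι, (if P H then bw U pi H else 0)
      ≤ ∑ H : Finset ι, ∑ S ∈ SS, (if S ⊆ H then bw U pi H else 0) := by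
        refine Finset.sum_le_sum (fun H _ => ?_)
        have hnn : ∀ S ∈ SS, 0 ≤ (if S ⊆ H then bw U pi H else 0) := by
          intro S _
          split_ifs
          · exact bw_nonneg h0 h1 H
          · exact le_rfl
        by_cases hPH : P H
        · rw [if_pos hPH]
          by_cases hHU : H ⊆ U
          · obtain ⟨S, hS, hSH⟩ := hP H hHU hPH
            refine le_trans ?_ (Finset.single_le_sum hnn hS)
            rw [if_pos hSH]
          · have : bw U pi H = 0 := if_neg hHU
            rw [this]
            exact Finset.sum_nonneg (fun S hS => by rw [this] at hnn; exact hnn S hS)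
        · rw [if_neg hPH]; exact Finset.sum_nonneg hnn
    _ = ∑ S ∈ SS, pi ^ S.card := by
        rw [Finset.sum_comm]
        exact Finset.sum_congr rfl (fun S hS => bw_contains U pi S (hSS S hS))

/-- Counting sets of `F`-edges with few vertices. -/
lemma count_small {r n : ℕ} (F : Finset (Finset (Fin r))) (k m : ℕ) (hm : m ≤ n) :
    ((allFEdges F n).powerset.filter (fun S => S.card = k ∧ (S.sup Prod.fst).card ≤ m)).card
      ≤ n ^ m * m ^ (k * r) := by
  set big : Finset (Fin k × Fin r → Fin n) := (Finset.powersetCard m (Finset.univ : Finset (Fin n))).biUnion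
    (fun T => Fintype.piFinset (fun _ => T)) with hbig
  have hbc : big.card ≤ n ^ m * m ^ (k * r) := by
    refine (Finset.card_biUnion_le_card_mul _ _ (m ^ (k * r)) (fun T hT => ?_)).trans ?_
    · rw [Fintype.card_piFinset, Finset.prod_const, (Finset.mem_powersetCard.1 hT).2]
      simp
    · refine Nat.mul_le_mul_right _ ?_
      rw [Finset.card_powersetCard, Finset.card_univ, Fintype.card_fin]
      exact Nat.choose_le_pow n m
  refine le_trans ?_ hbc
  set dec : (Fin k × Fin r → Fin n) → Finset (FE n) := fun f =>
    Finset.univ.image (fun a : Fin k => ((Finset.univ.image (fun x => f (a, x)),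
      F.image (fun e => e.image (fun x => f (a, x)))) : FE n)) with hdec
  refine le_trans (Finset.card_le_card ?_) (Finset.card_image_le (s := big) (f := dec))
  intro S hS
  obtain ⟨hS1, hSk, hSm⟩ := Finset.mem_filter.1 hS
  rw [Finset.mem_powerset] at hS1
  have hSF : ∀ h ∈ S, IsFEdge F n h := fun h hh => (Finset.mem_filter.1 (hS1 hh)).2
  set eq := S.equivFinOfCardEq hSk with heq
  choose φ hφ1 hφ2 using fun a : Fin k => hSF (eq.symm a) (eq.symm a).2
  rw [Finset.mem_image]
  obtain ⟨T, hT1, hT2⟩ := Finset.exists_superset_card_eq hSm (by simpa using hm)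
  refine ⟨fun q => φ q.1 q.2, ?_, ?_⟩
  · refine Finset.mem_biUnion.2 ⟨T, Finset.mem_powersetCard.2 ⟨Finset.subset_univ _, hT2⟩, ?_⟩
    rw [Fintype.mem_piFinset]
    rintro ⟨a, x⟩
    apply hT1
    rw [Finset.mem_sup]
    refine ⟨_, (eq.symm a).2, ?_⟩
    rw [hφ1]; exact Finset.mem_map_of_mem _ (Finset.mem_univ _)
  · have : ∀ a : Fin k, ((Finset.univ.image (fun x => φ a x),
      F.image (fun e => e.image (fun x => φ a x))) : FE n) = (eq.symm a : FE n) := by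
      intro a
      refine Prod.ext ?_ ?_
      · rw [hφ1 a, Finset.map_eq_image]
      · rw [hφ2 a]; simp only [Finset.map_eq_image]
    rw [hdec]
    simp only [this]
    ext h
    rw [Finset.mem_image]
    constructor
    · rintro ⟨a, _, rfl⟩; exact (eq.symm a).2
    · intro hh; exact ⟨eq ⟨h, hh⟩, Finset.mem_univ _, by simp⟩

lemma P_avoid {r n : ℕ} (hr : 4 ≤ r) (F : Finset (Finset (Fin r))) (pi : ℝ) (h0 : 0 ≤ pi) (h1 : pi ≤ 1)
    (hn : r * 2 ^ (r + 1) ≤ n) (η : ℝ) (hη : 0 ≤ η) (hpi : pi ≤ (n : ℝ) ^ (-((r : ℝ) - 1) + η)) :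
    ∑ H : Finset (FE n), (if HasAvoidable r H then bw (allFEdges F n) pi H else 0) ≤
      2 ^ (r + 1) * (((r * 2 ^ (r + 1)) ^ (2 ^ (r + 1) * r) : ℕ) * (n : ℝ) ^ (-1 + η * 2 ^ (r + 1))) := by
  set K := 2 ^ (r + 1) with hK
  have hKpos : 0 < K := by positivity
  have hn1 : 1 ≤ n := le_trans (by nlinarith) hn
  have hn' : (1 : ℝ) ≤ n := by exact_mod_cast hn1
  set Sk : ℕ → Finset (Finset (FE n)) := fun k =>
    (allFEdges F n).powerset.filter (fun S => S.card = k ∧ (S.sup Prod.fst).card ≤ (r - 1) * k - 1) with hSk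
  refine (union_bound (allFEdges F n) pi h0 h1 _ ((Finset.Icc 1 K).biUnion Sk) ?_ ?_).trans ?_
  · intro S hS
    obtain ⟨k, _, hS⟩ := Finset.mem_biUnion.1 hS
    exact Finset.mem_powerset.1 (Finset.mem_filter.1 hS).1
  · rintro H hH ⟨S, hS, hSne, _, hSc, hSK⟩
    refine ⟨S, Finset.mem_biUnion.2 ⟨S.card, Finset.mem_Icc.2 ⟨Finset.card_pos.2 hSne, hSK⟩,
      Finset.mem_filter.2 ⟨Finset.mem_powerset.2 (hS.trans hH), rfl, ?_⟩⟩, hS⟩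
    omega
  · rw [Finset.sum_biUnion]
    swap
    · intro k _ l _ hkl
      refine Finset.disjoint_left.2 (fun S h1 h2 => hkl ?_)
      rw [← (Finset.mem_filter.1 h1).2.1, ← (Finset.mem_filter.1 h2).2.1]
    have hterm : ∀ k ∈ Finset.Icc 1 K, ∑ S ∈ Sk k, pi ^ S.card ≤
        (((r * K) ^ (K * r) : ℕ) * (n : ℝ) ^ (-1 + η * K)) := by
      intro k hk
      obtain ⟨hk1, hkK⟩ := Finset.mem_Icc.1 hk
      have hk0 : 1 ≤ (r - 1) * k := Nat.mul_pos (by omega) hk1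
      have hm1 : (r - 1) * k - 1 ≤ r * K := by
        have : (r - 1) * k ≤ r * K := Nat.mul_le_mul (by omega) hkK
        omega
      have hc := count_small F k ((r - 1) * k - 1) (hm1.trans hn)
      have hc2 : ((r - 1) * k - 1) ^ (k * r) ≤ (r * K) ^ (K * r) := by
        refine (Nat.pow_le_pow_left hm1 _).trans ?_
        exact Nat.pow_le_pow_right (by nlinarith) (Nat.mul_le_mul_right _ hkK)
      have hc3 : (Sk k).card ≤ n ^ ((r - 1) * k - 1) * (r * K) ^ (K * r) :=
        hc.trans (Nat.mul_le_mul_left _ hc2)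
      calc ∑ S ∈ Sk k, pi ^ S.card = ∑ S ∈ Sk k, pi ^ k :=
            Finset.sum_congr rfl (fun S hS => by rw [(Finset.mem_filter.1 hS).2.1])
        _ = (Sk k).card * pi ^ k := by rw [Finset.sum_const, nsmul_eq_mul]
        _ ≤ ((n ^ ((r - 1) * k - 1) * (r * K) ^ (K * r) : ℕ) : ℝ) * ((n : ℝ) ^ (-((r : ℝ) - 1) + η)) ^ k := by
            refine mul_le_mul (by exact_mod_cast hc3) (pow_le_pow_left₀ h0 hpi k) (by positivity) (by positivity)
        _ = ((r * K) ^ (K * r) : ℕ) * ((n : ℝ) ^ ((r - 1) * k - 1) * ((n : ℝ) ^ (-((r : ℝ) - 1) + η)) ^ k) := by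
            push_cast; ring
        _ = ((r * K) ^ (K * r) : ℕ) * (n : ℝ) ^ (-1 + η * k) := by
            congr 1
            rw [← Real.rpow_natCast, ← Real.rpow_natCast, ← Real.rpow_mul (by linarith), ← Real.rpow_add (by linarith)]
            congr 1
            rw [Nat.cast_sub hk0, Nat.cast_mul, Nat.cast_sub (by omega : 1 ≤ r)]
            push_cast; ring
        _ ≤ _ := by
            refine mul_le_mul_of_nonneg_left ?_ (by positivity)
            apply Real.rpow_le_rpow_of_exponent_le hn'
            have : (k : ℝ) ≤ K := by exact_mod_cast hkK
            nlinarith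
    refine (Finset.sum_le_sum hterm).trans ?_
    rw [Finset.sum_const, Nat.card_Icc, nsmul_eq_mul]
    simp only [Nat.add_sub_cancel]
    rw [hK]; push_cast
    exact le_rfl

lemma deg_count {r n : ℕ} (F : Finset (Finset (Fin r))) (v : Fin n) :
    ((allFEdges F n).filter (fun h => v ∈ h.1)).card ≤ r * n ^ (r - 1) := by
  set big : Finset (Fin r → Fin n) := (Finset.univ : Finset (Fin r)).biUnion (fun x =>
    Fintype.piFinset (fun y => if y = x then {v} else Finset.univ)) with hbig
  have hbc : big.card ≤ r * n ^ (r - 1) := by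
    refine (Finset.card_biUnion_le_card_mul _ _ (n ^ (r - 1)) (fun x _ => ?_)).trans (by simp)
    rw [Fintype.card_piFinset, ← Finset.mul_prod_erase _ _ (Finset.mem_univ x), if_pos rfl,
      Finset.card_singleton, one_mul, Finset.prod_congr rfl (g := fun _ => n)]
    · rw [Finset.prod_const, Finset.card_erase_of_mem (Finset.mem_univ _)]; simp
    · intro c hc
      rw [if_neg (Finset.ne_of_mem_erase hc)]; simp
  refine le_trans ?_ hbc
  set dec : (Fin r → Fin n) → FE n := fun f => (Finset.univ.image f, F.image (fun e => e.image f)) with hdec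
  refine le_trans (Finset.card_le_card ?_) (Finset.card_image_le (s := big) (f := dec))
  intro h hh
  obtain ⟨hh1, hv⟩ := Finset.mem_filter.1 hh
  obtain ⟨φ, h1, h2⟩ := (Finset.mem_filter.1 hh1).2
  rw [h1] at hv
  obtain ⟨x, _, hx⟩ := Finset.mem_map.1 hv
  refine Finset.mem_image.2 ⟨φ, Finset.mem_biUnion.2 ⟨x, Finset.mem_univ _, ?_⟩, ?_⟩
  · rw [Fintype.mem_piFinset]
    intro y
    split_ifs with hy
    · rw [hy, hx]; simp
    · simp
  · refine Prod.ext ?_ ?_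
    · rw [h1, Finset.map_eq_image]
    · rw [h2]; simp only [Finset.map_eq_image, hdec]

lemma P_deg {r n : ℕ} (F : Finset (Finset (Fin r))) (pi : ℝ) (h0 : 0 ≤ pi) (h1 : pi ≤ 1) (D : ℕ) :
    ∑ H : Finset (FE n), (if ¬ (∀ v, degFE H v ≤ D) then bw (allFEdges F n) pi H else 0) ≤
      n * (Real.exp (2 * ((r * n ^ (r - 1) : ℕ) * pi)) / 2 ^ D) := by
  set Sv : Fin n → Finset (Finset (FE n)) := fun v =>
    Finset.powersetCard D ((allFEdges F n).filter (fun h => v ∈ h.1)) with hSv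
  have hv : ∀ v : Fin n, ∑ H : Finset (FE n), (if D < degFE H v then bw (allFEdges F n) pi H else 0) ≤
      (Real.exp (2 * ((r * n ^ (r - 1) : ℕ) * pi)) / 2 ^ D) := by
    intro v
    refine (union_bound (allFEdges F n) pi h0 h1 _ (Sv v) ?_ ?_).trans ?_
    · intro S hS
      exact (Finset.mem_powersetCard.1 hS).1.trans (Finset.filter_subset _ _)
    · intro H hH hD
      obtain ⟨S, hS, hSc⟩ := Finset.exists_subset_card_eq hD.le
      refine ⟨S, Finset.mem_powersetCard.2 ⟨hS.trans (Finset.filter_subset_filter _ hH), hSc⟩,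
        hS.trans (Finset.filter_subset _ _)⟩
    · rw [Finset.sum_congr rfl (fun S hS => by rw [(Finset.mem_powersetCard.1 hS).2])]
      rw [Finset.sum_const, Finset.card_powersetCard, nsmul_eq_mul]
      set d := ((allFEdges F n).filter (fun h => v ∈ h.1)).card with hd
      have hdle : (d : ℝ) ≤ (r * n ^ (r - 1) : ℕ) := by exact_mod_cast deg_count F v
      have e1 : ((d.choose D : ℕ) : ℝ) ≤ (d : ℝ) ^ D / (D.factorial : ℝ) := Nat.choose_le_pow_div D d
      have e2 := Real.pow_div_factorial_le_exp (2 * (d * pi)) (by positivity) D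
      rw [le_div_iff₀ (by positivity)]
      calc (d.choose D : ℝ) * pi ^ D * 2 ^ D ≤ (d : ℝ) ^ D / (D.factorial : ℝ) * pi ^ D * 2 ^ D := by gcongr
        _ = (2 * (d * pi)) ^ D / (D.factorial : ℝ) := by rw [mul_pow, mul_pow]; ring
        _ ≤ Real.exp (2 * (d * pi)) := e2
        _ ≤ _ := by gcongr
  calc ∑ H : Finset (FE n), (if ¬ (∀ v, degFE H v ≤ D) then bw (allFEdges F n) pi H else 0)
      ≤ ∑ H : Finset (FE n), ∑ v, (if D < degFE H v then bw (allFEdges F n) pi H else 0) := by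
        refine Finset.sum_le_sum (fun H _ => ?_)
        have hnn : ∀ v ∈ (Finset.univ : Finset (Fin n)), 0 ≤ (if D < degFE H v then bw (allFEdges F n) pi H else 0) := by
          intro v _
          split_ifs
          · exact bw_nonneg h0 h1 H
          · exact le_rfl
        split_ifs with h
        · exact Finset.sum_nonneg hnn
        · push Not at h
          obtain ⟨v, hv⟩ := h
          refine le_trans ?_ (Finset.single_le_sum hnn (Finset.mem_univ v))
          rw [if_pos hv]
    _ = ∑ v, ∑ H : Finset (FE n), (if D < degFE H v then bw (allFEdges F n) pi H else 0) := Finset.sum_comm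
    _ ≤ ∑ v : Fin n, (Real.exp (2 * ((r * n ^ (r - 1) : ℕ) * pi)) / 2 ^ D) := Finset.sum_le_sum (fun v _ => hv v)
    _ = _ := by simp

end Bad

section Assemble

lemma coupling_n {u r n : ℕ} (hu : 2 ≤ u) (F : Finset (Finset (Fin r))) (hFcard : ∀ e ∈ F, e.card = u)
    (hF : Nice u F) (D : ℕ) (p pi ε y b : ℝ) (hp0 : 0 < p) (hp1 : p ≤ 1) (hpi0 : 0 < pi) (hpi1 : pi < 1)
    (hε0 : 0 ≤ ε) (hε : ε ≤ 1) (hy0 : 0 ≤ y)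
    (hy : ∀ A ⊆ F, A.Nonempty → A ≠ F → p ^ (F.card - A.card) * (n : ℝ) ^ (kc A - 1) ≤ y)
    (hQ : 2 ^ F.card * ((r * (r * (1 + D * r) ^ r * ((1 + D * r) ^ r) ^ r) : ℕ) * y) ≤ ε)
    (hpi : pi ≤ p ^ F.card * (1 - ε))
    (hb : ∑ H : Finset (FE n), (if ¬ GoodH F n D H then bw (allFEdges F n) pi H else 0) ≤ b) :
    ∃ μ : PMF (Finset (Finset (Fin n)) × Finset (FE n)),
      BernoulliVia μ Prod.fst (allUEdges u n) p ∧ BernoulliVia μ Prod.snd (allFEdges F n) pi ∧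
      ENNReal.ofReal (1 - b) ≤ μ.toOuterMeasure {ω | ∀ h ∈ ω.2, h.2 ⊆ ω.1} ∧
      ∀ H₀ : Finset (FE n), (∀ h ∈ H₀, IsFEdge F n h) → ∀ h : FE n, IsFEdge F n h → h ∉ H₀ →
        μ.toOuterMeasure {ω | h.2 ⊆ ω.1 ∧ ω.2 = H₀} ≤
          ENNReal.ofReal ((p ^ ((h.2 \ H₀.sup Prod.snd).card) - pi) / (1 - pi)) *
            μ.toOuterMeasure {ω | ω.2 = H₀} := by
  set U := allUEdges u n with hU
  set E := EE F n with hE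
  set L := (allFEdges F n).toList with hL
  have hLn : L.Nodup := Finset.nodup_toList _
  have hLf : L.toFinset = allFEdges F n := Finset.toList_toFinset _
  have hEU : ∀ i, E i ⊆ U := EE_sub F hFcard
  set K : Finset (Finset (Fin n)) → Finset (FE n) → ℝ := fun G H => Kc U p E pi L ∅ ∅ G H with hK
  have hK0 : ∀ G H, 0 ≤ K G H := fun G H => Kc_nonneg U E hp0 hp1 hpi0 hpi1 L ∅ ∅ G H
  have hZ : Zf U p E ∅ ∅ = 1 := by rw [Zf_empty U p E ∅ (by simp)]; simp
  have hG : ∀ G, ∑ H, K G H = bw U p G := by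
    intro G
    have := Kc_margG U E hp0 hp1 hpi0 hpi1 L hLn ∅ ∅ G
    rw [hK]
    simp only
    rw [this, Pc, hZ, if_pos ⟨by simp, by simp⟩]; simp
  have hH : ∀ H, ∑ G, K G H = bw (allFEdges F n) pi H := by
    intro H
    have := Kc_margH U E hp0 hp1 hpi0 hpi1 L hLn ∅ ∅ H
    rw [hK]
    simp only
    rw [this, tauc_eq, hZ, hLf]; simp
  have htot : ∑ ω : Finset (Finset (Fin n)) × Finset (FE n), ENNReal.ofReal (K ω.1 ω.2) = 1 := by
    rw [← ENNReal.ofReal_sum_of_nonneg (fun ω _ => hK0 _ _), Fintype.sum_prod_type]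
    simp only [hG, bw_total, ENNReal.ofReal_one]
  set μ : PMF (Finset (Finset (Fin n)) × Finset (FE n)) :=
    PMF.ofFintype (fun ω => ENNReal.ofReal (K ω.1 ω.2)) htot with hμ
  have hmeas : ∀ S : Set (Finset (Finset (Fin n)) × Finset (FE n)),
      μ.toOuterMeasure S = ENNReal.ofReal (∑ G, ∑ H, if (G, H) ∈ S then K G H else 0) := by
    intro S
    rw [PMF.toOuterMeasure_apply_fintype, ← Fintype.sum_prod_type (f := fun ω : Finset (Finset (Fin n)) × Finset (FE n) => if ω ∈ S then K ω.1 ω.2 else 0),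
      ENNReal.ofReal_sum_of_nonneg]
    · refine Finset.sum_congr rfl (fun ω _ => ?_)
      rw [Set.indicator_apply]
      split_ifs <;> simp [hμ]
    · intro ω _
      split_ifs
      · exact hK0 _ _
      · exact le_rfl
  have hmH : ∀ A, μ.toOuterMeasure {ω | ω.2 = A} = ENNReal.ofReal (bw (allFEdges F n) pi A) := by
    intro A
    rw [hmeas]
    congr 1
    rw [← hH A]
    refine Finset.sum_congr rfl (fun G _ => ?_)
    rw [Finset.sum_eq_single A]
    · simp
    · intro H _ hne; simp [hne]
    · simp
  refine ⟨μ, ?_, ?_, ?_, ?_⟩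
  · intro A
    rw [hmeas]
    refine (congrArg ENNReal.ofReal (?_ : _ = bw U p A)).trans ?_
    · rw [← hG A, Finset.sum_eq_single A]
      · simp
      · intro G _ hGA; simp [hGA]
      · simp
    · rw [bw]
      split_ifs <;> simp
  · intro A
    rw [hmH, bw]
    split_ifs <;> simp
  · rw [hmeas]
    apply ENNReal.ofReal_le_ofReal
    have h1 : ∑ H : Finset (FE n), (if GoodH F n D H then bw (allFEdges F n) pi H else 0) =
        1 - ∑ H : Finset (FE n), (if ¬ GoodH F n D H then bw (allFEdges F n) pi H else 0) := by
      rw [← bw_total (allFEdges F n) pi, ← Finset.sum_sub_distrib]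
      refine Finset.sum_congr rfl (fun H _ => ?_)
      by_cases h : GoodH F n D H <;> simp [h]
    refine le_trans (by linarith : 1 - b ≤ ∑ H : Finset (FE n), (if GoodH F n D H then bw (allFEdges F n) pi H else 0)) ?_
    · rw [Finset.sum_comm]
      refine Finset.sum_le_sum (fun H _ => ?_)
      split_ifs with hgd
      · rw [← hH H]
        refine Finset.sum_le_sum (fun G _ => ?_)
        split_ifs with hm
        · exact le_rfl
        · by_contra hcon
          have hne : K G H ≠ 0 := fun h => hcon h.le
          apply hm
          intro i hi
          have hfirst := Kc_first U E hp0 hp1 hpi0 hpi1 (GoodH F n D)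
            (fun H' Hp N a hgd' hs ha _ haN hZ' => hgood_lemma hu F hFcard hF D p pi ε y hp0 hp1 hε hy0 hy hQ hpi
              H' Hp N a hgd' hs ha haN hZ') L hLn ∅ ∅ G H (by simp) (by simpa using hgd) (by
                have : Gof E (∅ : Finset (FE n)) = ∅ := by simp [Gof]
                rw [this]; exact hne) i hi
          rwa [show E i = i.2 from EE_of (hgd.1 i hi)] at hfirst
      · refine Finset.sum_nonneg (fun G _ => ?_)
        split_ifs
        · exact hK0 _ _
        · exact le_rfl
  · intro H₀ hH₀ h hh hhH
    rw [hmH, hmeas]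
    have hGof : Gof E H₀ = H₀.sup Prod.snd := by
      unfold Gof
      exact Finset.sup_congr rfl (fun i hi => EE_of (hH₀ i hi))
    have hEh : E h = h.2 := EE_of hh
    have hps : pi ≤ p ^ F.card := by
      refine hpi.trans ?_
      have : 0 < p ^ F.card := pow_pos hp0 _
      nlinarith
    have hcoef : 0 ≤ (p ^ ((h.2 \ H₀.sup Prod.snd).card) - pi) / (1 - pi) := by
      apply div_nonneg _ (by linarith)
      have : p ^ F.card ≤ p ^ ((h.2 \ H₀.sup Prod.snd).card) := by
        apply pow_le_pow_of_le_one hp0.le hp1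
        rw [← hh.card_snd]
        exact Finset.card_le_card Finset.sdiff_subset
      linarith
    rw [← ENNReal.ofReal_mul hcoef]
    apply ENNReal.ofReal_le_ofReal
    have hsec := Kc_second U E hp0 hp1 hpi0 hpi1 hEU h (by rw [hEh, hh.card_snd]; exact hps) L hLn
      (by rw [hL, Finset.mem_toList]; exact Finset.mem_filter.2 ⟨Finset.mem_univ _, hh⟩) ∅ ∅ H₀ (by simp) hhH
    rw [hLf, Finset.empty_union, hGof, hEh] at hsec
    refine le_trans (le_of_eq ?_) hsec
    refine Finset.sum_congr rfl (fun G _ => ?_)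
    rw [Finset.sum_eq_single H₀]
    · simp [hK]
    · intro H _ hne; simp [hne]
    · simp

lemma bad_le {r n : ℕ} (F : Finset (Finset (Fin r))) (D : ℕ) (pi : ℝ) (h0 : 0 ≤ pi) (h1 : pi ≤ 1) :
    ∑ H : Finset (FE n), (if ¬ GoodH F n D H then bw (allFEdges F n) pi H else 0) ≤
      ∑ H : Finset (FE n), (if HasAvoidable r H then bw (allFEdges F n) pi H else 0) +
      ∑ H : Finset (FE n), (if ¬ (∀ v, degFE H v ≤ D) then bw (allFEdges F n) pi H else 0) := by
  rw [← Finset.sum_add_distrib]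
  refine Finset.sum_le_sum (fun H _ => ?_)
  have hb := bw_nonneg (U := allFEdges F n) h0 h1 H
  by_cases hsub : H ⊆ allFEdges F n
  · by_cases ha : HasAvoidable r H
    · rw [if_pos ha]
      have : (if ¬ GoodH F n D H then bw (allFEdges F n) pi H else 0) ≤ bw (allFEdges F n) pi H := by
        split_ifs <;> linarith
      have h2 : 0 ≤ (if ¬ (∀ v, degFE H v ≤ D) then bw (allFEdges F n) pi H else 0) := by
        split_ifs <;> linarith
      linarith
    · by_cases hd : ∀ v, degFE H v ≤ D
      · have : GoodH F n D H := ⟨fun h hh => (Finset.mem_filter.1 (hsub hh)).2, ha, hd⟩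
        simp [this, ha, hd]
      · have : ¬ GoodH F n D H := fun h => hd h.2.2
        simp [this, ha, hd]
  · have : bw (allFEdges F n) pi H = 0 := if_neg hsub
    simp [this]

end Assemble

section Asymp

lemma ev_const (C a : ℝ) (ha : 0 < a) : ∀ᶠ n : ℕ in atTop, C ≤ (n : ℝ) ^ a :=
  ((tendsto_rpow_atTop ha).comp tendsto_natCast_atTop_atTop).eventually_ge_atTop C

lemma ev_log (C a : ℝ) (ha : 0 < a) : ∀ᶠ n : ℕ in atTop, C * Real.log n ≤ (n : ℝ) ^ a := by
  have h := (isLittleO_log_rpow_atTop ha).bound (c := 1 / (|C| + 1)) (by positivity)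
  have h2 := tendsto_natCast_atTop_atTop (R := ℝ) |>.eventually h
  filter_upwards [h2, eventually_ge_atTop 1] with n hn h1
  have hl : 0 ≤ Real.log n := Real.log_natCast_nonneg n
  have hp : (0 : ℝ) ≤ (n : ℝ) ^ a := by positivity
  rw [Real.norm_of_nonneg hl, Real.norm_of_nonneg hp, div_mul_eq_mul_div, one_mul, le_div_iff₀ (by positivity)] at hn
  have : C ≤ |C| := le_abs_self C
  nlinarith

lemma ev_g (g : ℕ → ℝ) (hg : GoodG g) : ∀ᶠ n : ℕ in atTop, 0 < g n ∧ g n ≤ Real.log n := by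
  have h1 := hg.2.bound (c := 1) one_pos
  have hlog : Tendsto (fun n : ℕ => Real.log n) atTop atTop :=
    Real.tendsto_log_atTop.comp tendsto_natCast_atTop_atTop
  have h2 := (Real.tendsto_log_atTop.comp hlog).eventually_ge_atTop 1
  filter_upwards [h1, h2, hg.1.eventually_gt_atTop 0, hlog.eventually_ge_atTop 0] with n h1 h2 h3 h4
  refine ⟨h3, ?_⟩
  simp only [Function.comp] at h2
  rw [Real.norm_of_nonneg h3.le, one_mul, Real.norm_of_nonneg (div_nonneg h4 (by linarith))] at h1
  exact h1.trans (div_le_self h4 h2)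

lemma ev_pi {r : ℕ} (hr : 4 ≤ r) (F : Finset (Finset (Fin r))) (g : ℕ → ℝ) (hg : GoodG g) (η : ℝ) (hη : 0 < η) :
    ∀ᶠ n : ℕ in atTop, 0 < piPlus F g n ∧ piPlus F g n ≤ (n : ℝ) ^ (-((r : ℝ) - 1) + η) := by
  filter_upwards [ev_g g hg, ev_log (2 * (((r - 1).factorial : ℕ) * 2 ^ (r - 1))) η hη,
    eventually_ge_atTop (2 * r)] with n hgn hlog hn
  obtain ⟨hg0, hg1⟩ := hgn
  have haut0 : 0 < autCard F := by
    unfold autCard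
    have : Nonempty {σ : Equiv.Perm (Fin r) // F.image (fun e => e.image (fun x => σ x)) = F} :=
      ⟨⟨1, by simp⟩⟩
    exact Fintype.card_pos
  have haut1 : autCard F ≤ r.factorial := by
    unfold autCard
    refine (Fintype.card_subtype_le _).trans ?_
    rw [Fintype.card_perm, Fintype.card_fin]
  have hch0 : 0 < (n - 1).choose (r - 1) := Nat.choose_pos (by omega)
  have hn0 : (0 : ℝ) < n := by exact_mod_cast (by omega : 0 < n)
  have hch : (n : ℝ) ^ (r - 1) ≤ ((r - 1).factorial : ℕ) * 2 ^ (r - 1) * ((n - 1).choose (r - 1) : ℝ) := by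
    have h1 : (n - 1 + 1 - (r - 1)) ^ (r - 1) ≤ (r - 1).factorial * (n - 1).choose (r - 1) := by
      rw [← Nat.descFactorial_eq_factorial_mul_choose]
      exact Nat.pow_sub_le_descFactorial (n - 1) (r - 1)
    have h2 : n ^ (r - 1) ≤ 2 ^ (r - 1) * (n - 1 + 1 - (r - 1)) ^ (r - 1) := by
      rw [← mul_pow]
      exact Nat.pow_le_pow_left (by omega) _
    have h3 : n ^ (r - 1) ≤ (r - 1).factorial * 2 ^ (r - 1) * (n - 1).choose (r - 1) := by
      refine h2.trans ((Nat.mul_le_mul_left _ h1).trans (le_of_eq (by ring)))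
    exact_mod_cast h3
  have hlog0 : 0 ≤ Real.log n := Real.log_natCast_nonneg n
  have ha : (0 : ℝ) < (autCard F : ℝ) / (r.factorial : ℝ) := by positivity
  have ha1 : (autCard F : ℝ) / (r.factorial : ℝ) ≤ 1 := by
    rw [div_le_one (by positivity)]; exact_mod_cast haut1
  have hch0' : (0 : ℝ) < ((n - 1).choose (r - 1) : ℝ) := by exact_mod_cast hch0
  unfold piPlus
  refine ⟨mul_pos ha (div_pos (by linarith) hch0'), ?_⟩
  have h3 : (Real.log n + g n) / ((n - 1).choose (r - 1) : ℝ) ≤ (n : ℝ) ^ (-((r : ℝ) - 1) + η) := by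
    rw [div_le_iff₀ hch0', Real.rpow_add hn0]
    have e1 : (n : ℝ) ^ (-((r : ℝ) - 1)) * (n : ℝ) ^ (r - 1) = 1 := by
      rw [← Real.rpow_natCast, ← Real.rpow_add hn0, Nat.cast_sub (by omega)]
      simp
    have hpos : 0 < (n : ℝ) ^ (-((r : ℝ) - 1)) := Real.rpow_pos_of_pos hn0 _
    have h4 : 1 ≤ (n : ℝ) ^ (-((r : ℝ) - 1)) * (((r - 1).factorial : ℕ) * 2 ^ (r - 1) * ((n - 1).choose (r - 1) : ℝ)) := by
      exact e1.symm.le.trans (mul_le_mul_of_nonneg_left hch hpos.le)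
    calc Real.log n + g n ≤ 2 * Real.log n * 1 := by linarith
      _ ≤ 2 * Real.log n * ((n : ℝ) ^ (-((r : ℝ) - 1)) * (((r - 1).factorial : ℕ) * 2 ^ (r - 1) * ((n - 1).choose (r - 1) : ℝ))) := by
          gcongr
      _ = (n : ℝ) ^ (-((r : ℝ) - 1)) * (2 * (((r - 1).factorial : ℕ) * 2 ^ (r - 1)) * Real.log n) * ((n - 1).choose (r - 1) : ℝ) := by ring
      _ ≤ _ := by gcongr
  calc _ ≤ 1 * ((Real.log n + g n) / ((n - 1).choose (r - 1) : ℝ)) := by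
        refine mul_le_mul_of_nonneg_right ha1 (div_nonneg (by linarith) hch0'.le)
    _ ≤ _ := by rw [one_mul]; exact h3

/-- The error bound. -/
def bfun (r : ℕ) (η : ℝ) (n : ℕ) : ℝ :=
  2 ^ (r + 1) * (((r * 2 ^ (r + 1)) ^ (2 ^ (r + 1) * r) : ℕ) * (n : ℝ) ^ (-1 + η * 2 ^ (r + 1))) +
    ((n : ℝ) ^ η) ^ (1 / η) * Real.exp (-1 * (n : ℝ) ^ η)

lemma bfun_tendsto (r : ℕ) (η : ℝ) (hη : 0 < η) (h : η * 2 ^ (r + 1) < 1) :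
    Tendsto (bfun r η) atTop (nhds 0) := by
  have h1 : Tendsto (fun n : ℕ => (n : ℝ) ^ (-1 + η * 2 ^ (r + 1))) atTop (nhds 0) := by
    have := (tendsto_rpow_neg_atTop (y := 1 - η * 2 ^ (r + 1)) (by linarith)).comp
      (tendsto_natCast_atTop_atTop (R := ℝ))
    refine this.congr (fun n => ?_)
    simp only [Function.comp]
    congr 1; ring
  have h2 : Tendsto (fun n : ℕ => ((n : ℝ) ^ η) ^ (1 / η) * Real.exp (-1 * (n : ℝ) ^ η)) atTop (nhds 0) :=
    (tendsto_rpow_mul_exp_neg_mul_atTop_nhds_zero (1 / η) 1 one_pos).comp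
      ((tendsto_rpow_atTop hη).comp tendsto_natCast_atTop_atTop)
  have := ((h1.const_mul (((r * 2 ^ (r + 1)) ^ (2 ^ (r + 1) * r) : ℕ) : ℝ)).const_mul (2 ^ (r + 1))).add h2
  simp only [mul_zero, add_zero] at this
  exact this

lemma hQ_aux {r : ℕ} (hr : 4 ≤ r) (s : ℕ) (hs' : (1 : ℝ) ≤ s) (η : ℝ) (hη0 : 0 < η)
    (hηq : 2 * η * ((r : ℝ) ^ 2 + r + 1) ≤ 1 / (4 * s)) (n : ℕ) (hn0 : (0 : ℝ) < n) (hn1 : (1 : ℝ) ≤ n)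
    (hnC : (2 : ℝ) ^ s * (r * r * (3 * r) ^ (r + r * r)) ≤ (n : ℝ) ^ (1 / (4 * s : ℝ)))
    (D : ℕ) (hone : 1 ≤ (n : ℝ) ^ (2 * η)) (hDle : (D : ℝ) ≤ 2 * (n : ℝ) ^ (2 * η)) :
    2 ^ s * ((r * (r * (1 + D * r) ^ r * ((1 + D * r) ^ r) ^ r) : ℕ) * (n : ℝ) ^ (-1 / (s : ℝ) + η)) ≤
      (n : ℝ) ^ (-(1 / (2 * s : ℝ))) := by
  have hr' : (4 : ℝ) ≤ r := by exact_mod_cast hr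
  have hbase : (1 : ℝ) + D * r ≤ 3 * r * (n : ℝ) ^ (2 * η) := by
    have a1 := mul_le_mul_of_nonneg_right hDle (by positivity : (0 : ℝ) ≤ r)
    have a2 : (1 : ℝ) * 1 ≤ r * (n : ℝ) ^ (2 * η) := mul_le_mul (by linarith) hone (by norm_num) (by linarith)
    linarith
  have h1 : ((r * (r * (1 + D * r) ^ r * ((1 + D * r) ^ r) ^ r) : ℕ) : ℝ) = r * r * (1 + D * r : ℝ) ^ (r + r * r) := by
    push_cast; rw [pow_add, pow_mul]; ring
  have h2 : (1 + D * r : ℝ) ^ (r + r * r) ≤ (3 * r) ^ (r + r * r) * (n : ℝ) ^ (2 * η * (r + r * r)) := by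
    refine (pow_le_pow_left₀ (by positivity) hbase _).trans (le_of_eq ?_)
    rw [mul_pow, Real.rpow_mul hn0.le (2 * η), ← Real.rpow_natCast ((n : ℝ) ^ (2 * η))]
    push_cast; rfl
  rw [h1]
  have h0y : (n : ℝ) ^ (2 * η * (r + r * r)) * (n : ℝ) ^ (-1 / (s : ℝ) + η) ≤ (n : ℝ) ^ (-(1 / (4 * s : ℝ))) * (n : ℝ) ^ (-(1 / (2 * s : ℝ))) := by
    rw [← Real.rpow_add hn0, ← Real.rpow_add hn0]
    apply Real.rpow_le_rpow_of_exponent_le hn1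
    have e1 : 2 * η * (r + r * r) + η ≤ 2 * η * ((r : ℝ) ^ 2 + r + 1) := by nlinarith
    have e2 : -1 / (s : ℝ) + 1 / (4 * s) = -(1 / (4 * s)) + -(1 / (2 * s : ℝ)) := by field_simp; norm_num
    linarith
  have hinv : (n : ℝ) ^ (1 / (4 * s : ℝ)) * (n : ℝ) ^ (-(1 / (4 * s : ℝ))) = 1 := by
    rw [← Real.rpow_add hn0]; simp
  calc (2 : ℝ) ^ s * (r * r * (1 + D * r : ℝ) ^ (r + r * r) * (n : ℝ) ^ (-1 / (s : ℝ) + η))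
      ≤ 2 ^ s * (r * r * ((3 * r) ^ (r + r * r) * (n : ℝ) ^ (2 * η * (r + r * r))) * (n : ℝ) ^ (-1 / (s : ℝ) + η)) := by gcongr
    _ = (2 ^ s * (r * r * (3 * r) ^ (r + r * r))) * ((n : ℝ) ^ (2 * η * (r + r * r)) * (n : ℝ) ^ (-1 / (s : ℝ) + η)) := by ring
    _ ≤ (n : ℝ) ^ (1 / (4 * s : ℝ)) * ((n : ℝ) ^ (-(1 / (4 * s : ℝ))) * (n : ℝ) ^ (-(1 / (2 * s : ℝ)))) := by
        refine mul_le_mul hnC h0y (by positivity) (by positivity)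
    _ = (n : ℝ) ^ (-(1 / (2 * s : ℝ))) := by rw [← mul_assoc, hinv, one_mul]

lemma deg_aux {r : ℕ} (hr : 4 ≤ r) (η : ℝ) (n : ℕ) (hn0 : (0 : ℝ) < n) (hrn : 1 ≤ n)
    (pi : ℝ) (hpiX : pi ≤ (n : ℝ) ^ (-((r : ℝ) - 1) + η)) (D : ℕ) (hDge : (n : ℝ) ^ (2 * η) ≤ D)
    (hnD : (2 * r + 1) / Real.log 2 ≤ (n : ℝ) ^ η) : 
    Real.exp (2 * ((r * n ^ (r - 1) : ℕ) * pi)) / 2 ^ D ≤ Real.exp (-1 * (n : ℝ) ^ η) := by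
  have hl2 : 0 < Real.log 2 := Real.log_pos (by norm_num)
  set t := (n : ℝ) ^ η with ht
  have htt : (n : ℝ) ^ (2 * η) = t * t := by
    rw [ht, ← Real.rpow_add hn0]; congr 1; ring
  have ht0 : 0 < t := Real.rpow_pos_of_pos hn0 _
  have e1 : (2 : ℝ) ^ D = Real.exp (Real.log 2 * D) := by
    rw [Real.exp_mul, Real.exp_log (by norm_num), Real.rpow_natCast]
  rw [e1, ← Real.exp_sub]
  apply Real.exp_le_exp.2
  have e2 : (n : ℝ) ^ (r - 1) * pi ≤ t := by
    have := mul_le_mul_of_nonneg_left hpiX (by positivity : (0 : ℝ) ≤ (n : ℝ) ^ (r - 1))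
    refine this.trans (le_of_eq ?_)
    rw [ht, ← Real.rpow_natCast, ← Real.rpow_add hn0, Nat.cast_sub (by omega)]
    congr 1; push_cast; ring
  rw [div_le_iff₀ hl2] at hnD
  have e3 : Real.log 2 * (t * t) ≤ Real.log 2 * D := by rw [← htt]; gcongr
  push_cast
  have e4 : (r : ℝ) * (n : ℝ) ^ (r - 1) * pi ≤ r * t := by
    rw [mul_assoc]; gcongr
  have e5 := mul_le_mul_of_nonneg_right hnD ht0.le
  nlinarith

set_option maxHeartbeats 1000000 in
lemma ev_main {u r : ℕ} (hu : 2 ≤ u) (hr : 4 ≤ r) (F : Finset (Finset (Fin r)))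
    (hFcard : ∀ e ∈ F, e.card = u) (hF : Nice u F) (g : ℕ → ℝ) (hg : GoodG g) :
    ∃ δ : ℝ, 0 < δ ∧ ∃ b : ℕ → ℝ, Tendsto b atTop (nhds 0) ∧ ∀ᶠ n : ℕ in atTop,
      ∃ μ : PMF (Finset (Finset (Fin n)) × Finset (FE n)),
        BernoulliVia μ Prod.fst (allUEdges u n) (pPlus F g δ n) ∧
        BernoulliVia μ Prod.snd (allFEdges F n) (piPlus F g n) ∧
        ENNReal.ofReal (1 - b n) ≤ μ.toOuterMeasure {ω | ∀ h ∈ ω.2, h.2 ⊆ ω.1} ∧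
        ∀ H₀ : Finset (FE n), (∀ h ∈ H₀, IsFEdge F n h) → ∀ h : FE n, IsFEdge F n h → h ∉ H₀ →
          μ.toOuterMeasure {ω | h.2 ⊆ ω.1 ∧ ω.2 = H₀} ≤
            ENNReal.ofReal ((pPlus F g δ n ^ ((h.2 \ H₀.sup Prod.snd).card) - piPlus F g n) /
              (1 - piPlus F g n)) * μ.toOuterMeasure {ω | ω.2 = H₀} := by
  have hs : 0 < F.card := by
    obtain ⟨e, he, _⟩ := hF.2.1.vert ⟨0, by omega⟩
    exact Finset.card_pos.2 ⟨e, he⟩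
  set s := F.card with hsdef
  have hs' : (1 : ℝ) ≤ s := by exact_mod_cast hs
  set K : ℝ := 2 ^ (r + 1) with hK
  have hK1 : 1 ≤ K := one_le_pow₀ (by norm_num)
  set q : ℝ := (r : ℝ) ^ 2 + r + 1 with hq
  have hr' : (4 : ℝ) ≤ r := by exact_mod_cast hr
  have hq1 : 1 ≤ q := by nlinarith
  set η : ℝ := 1 / (8 * s * q * K) with hη
  have hη0 : 0 < η := by positivity
  have hηK : η * K ≤ 1 / 8 := by
    have : η * K = 1 / (8 * s * q) := by rw [hη]; field_simp
    rw [this]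
    apply one_div_le_one_div_of_le (by norm_num)
    nlinarith
  have hηq : 2 * η * q ≤ 1 / (4 * s) := by
    have : 2 * η * q = 1 / (4 * s * K) := by rw [hη]; field_simp; norm_num
    rw [this]
    apply one_div_le_one_div_of_le (by positivity)
    nlinarith
  have hη1 : η ≤ 1 / 8 := by nlinarith
  set δ : ℝ := 1 / (2 * s) with hδ
  have hδ0 : 0 < δ := by positivity
  refine ⟨δ, hδ0, bfun r η, bfun_tendsto r η hη0 (by rw [← hK]; linarith), ?_⟩
  set Cc : ℝ := 2 ^ s * (r * r * (3 * r) ^ (r + r * r)) with hCc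
  filter_upwards [ev_pi hr F g hg (η / 2) (by linarith), ev_const 2 δ hδ0, ev_const 2 (η / 2) (by linarith),
    ev_const Cc (1 / (4 * s)) (by positivity), ev_const ((2 * r + 1) / Real.log 2) η hη0,
    eventually_ge_atTop (r * 2 ^ (r + 1)), eventually_ge_atTop 2] with n hpi hnδ hnη hnC hnD hn hn2
  obtain ⟨hpi0, hpi1⟩ := hpi
  have hn0 : (0 : ℝ) < n := by exact_mod_cast (by omega : 0 < n)
  have hn1 : (1 : ℝ) ≤ n := by exact_mod_cast (by omega : 1 ≤ n)
  set pi := piPlus F g n with hpidef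
  set p := pPlus F g δ n with hpdef
  set ε : ℝ := (n : ℝ) ^ (-δ) with hε
  have hε0 : 0 < ε := Real.rpow_pos_of_pos hn0 _
  have hε2 : ε ≤ 1 / 2 := by
    rw [hε, Real.rpow_neg hn0.le, ← one_div]
    exact one_div_le_one_div_of_le (by norm_num) hnδ
  set X : ℝ := pi / (1 - ε) with hX
  have hX0 : 0 < X := div_pos hpi0 (by linarith)
  have hsplit : (n : ℝ) ^ (-((r : ℝ) - 1) + η) = (n : ℝ) ^ (-((r : ℝ) - 1) + η / 2) * (n : ℝ) ^ (η / 2) := by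
    rw [← Real.rpow_add hn0]; congr 1; ring
  have hA0 : 0 < (n : ℝ) ^ (-((r : ℝ) - 1) + η / 2) := Real.rpow_pos_of_pos hn0 _
  have hXle : X ≤ (n : ℝ) ^ (-((r : ℝ) - 1) + η) := by
    rw [hX, div_le_iff₀ (by linarith), hsplit, mul_assoc]
    have hB : 1 ≤ (n : ℝ) ^ (η / 2) * (1 - ε) := by nlinarith
    exact hpi1.trans (le_mul_of_one_le_right hA0.le hB)
  have hpiX : pi ≤ (n : ℝ) ^ (-((r : ℝ) - 1) + η) := by
    rw [hsplit]; exact hpi1.trans (le_mul_of_one_le_right hA0.le (by linarith))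
  have hlt1 : (n : ℝ) ^ (-((r : ℝ) - 1) + η) < 1 :=
    Real.rpow_lt_one_of_one_lt_of_neg (by exact_mod_cast (by omega : 1 < n)) (by linarith)
  have hpeq : p = X ^ ((1 : ℝ) / (s : ℝ)) := rfl
  have hp0 : 0 < p := by rw [hpeq]; exact Real.rpow_pos_of_pos hX0 _
  have hp1 : p ≤ 1 := by
    rw [hpeq]; exact Real.rpow_le_one hX0.le (by linarith) (by positivity)
  have hps : p ^ s = X := by
    rw [hpeq, ← Real.rpow_natCast, ← Real.rpow_mul hX0.le]
    rw [one_div_mul_cancel (by positivity), Real.rpow_one]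
  have hple : p ≤ (n : ℝ) ^ ((-((r : ℝ) - 1) + η) / s) := by
    rw [hpeq]
    refine (Real.rpow_le_rpow hX0.le hXle (by positivity)).trans (le_of_eq ?_)
    rw [← Real.rpow_mul hn0.le]; congr 1; ring
  set D : ℕ := ⌈(n : ℝ) ^ (2 * η)⌉₊ with hD
  have hDge : (n : ℝ) ^ (2 * η) ≤ D := Nat.le_ceil _
  have hone : 1 ≤ (n : ℝ) ^ (2 * η) := Real.one_le_rpow hn1 (by linarith)
  have hDle : (D : ℝ) ≤ 2 * (n : ℝ) ^ (2 * η) := by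
    have := (Nat.ceil_lt_add_one (by linarith : 0 ≤ (n : ℝ) ^ (2 * η))).le
    linarith
  set y : ℝ := (n : ℝ) ^ (-1 / (s : ℝ) + η) with hy
  have hy0 : 0 ≤ y := by positivity
  have hQ : 2 ^ F.card * ((r * (r * (1 + D * r) ^ r * ((1 + D * r) ^ r) ^ r) : ℕ) * y) ≤ ε := by
    exact hQ_aux hr s hs' η hη0 (by rw [← hq]; exact hηq) n hn0 hn1 (by rw [← hCc]; exact hnC) D hone hDle
  refine coupling_n hu F hFcard hF D p pi ε y (bfun r η n) hp0 hp1 hpi0 (by linarith) hε0.le (by linarith) hy0 ?_ hQ ?_ ?_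
  · intro A hA hne hAF
    exact yBound hu F hFcard hF.1 n (by omega) p hp0.le η hη0.le hs hple (by omega) A hA hne hAF
  · rw [← hsdef, hps, hX, div_mul_cancel₀ _ (by linarith)]
  · refine (bad_le F D pi hpi0.le (by linarith)).trans ?_
    unfold bfun
    refine add_le_add (P_avoid hr F pi hpi0.le (by linarith) hn η hη0.le hpiX) ?_
    refine (P_deg F pi hpi0.le (by linarith) D).trans ?_
    have e0 : ((n : ℝ) ^ η) ^ (1 / η) = n := by
      rw [← Real.rpow_mul hn0.le, mul_one_div_cancel hη0.ne', Real.rpow_one]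
    rw [e0]
    refine mul_le_mul_of_nonneg_left ?_ hn0.le
    exact deg_aux hr η n hn0 (by omega) pi hpiX D hDge hnD

end Asymp

/-- There is `δ = δ(F) > 0` such that `G = H_u(n,p₊)` and
`H = H_F(n,π₊)` may be coupled so that whp every `F`-edge of `H` is in `G`, and
moreover, conditionally on `H = H₀` for any well-behaved `H₀`, the probability that the
copy of `F` corresponding to an `F`-edge `h ∉ H₀` is in `G` is at most
`(π* - π₊)/(1 - π₊)` with `π* = p₊^{|E_j \ E(G₀)|}`. -/
theorem statement_7 (u r : ℕ) (hu : 2 ≤ u) (hr : 4 ≤ r)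
    (F : Finset (Finset (Fin r))) (hFcard : ∀ e ∈ F, e.card = u) (hF : Nice u F)
    (g : ℕ → ℝ) (hg : GoodG g) :
    ∃ δ : ℝ, 0 < δ ∧
      ∃ μ : (n : ℕ) → PMF (Finset (Finset (Fin n)) × Finset (FE n)),
        (∀ᶠ n : ℕ in atTop,
          BernoulliVia (μ n) Prod.fst (allUEdges u n) (pPlus F g δ n)) ∧
        (∀ᶠ n : ℕ in atTop,
          BernoulliVia (μ n) Prod.snd (allFEdges F n) (piPlus F g n)) ∧
        Tendsto (fun n => (μ n).toOuterMeasure {ω | ∀ h ∈ ω.2, h.2 ⊆ ω.1})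
          atTop (nhds 1) ∧
        (∀ᶠ n : ℕ in atTop, ∀ H₀ : Finset (FE n),
          0 < (μ n).toOuterMeasure {ω | ω.2 = H₀} →
          (∀ h ∈ H₀, IsFEdge F n h) →
          (∀ v : Fin n, (degFE H₀ v : ℝ) ≤
            (r : ℝ) / n * (Mnum F n : ℝ) * piPlus F g n +
              max ((r : ℝ) / n * (Mnum F n : ℝ) * piPlus F g n) (3 * Real.log n)) →
          ¬ HasAvoidable r H₀ →
          ∀ h : FE n, IsFEdge F n h → h ∉ H₀ →
            (μ n).toOuterMeasure {ω | h.2 ⊆ ω.1 ∧ ω.2 = H₀} ≤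
              ENNReal.ofReal
                ((pPlus F g δ n ^ ((h.2 \ H₀.sup Prod.snd).card) - piPlus F g n) /
                  (1 - piPlus F g n)) *
                (μ n).toOuterMeasure {ω | ω.2 = H₀}) := by
  obtain ⟨δ, hδ, b, hb, hev⟩ := ev_main hu hr F hFcard hF g hg
  refine ⟨δ, hδ, fun n => if h : ∃ μ : PMF (Finset (Finset (Fin n)) × Finset (FE n)),
        BernoulliVia μ Prod.fst (allUEdges u n) (pPlus F g δ n) ∧
        BernoulliVia μ Prod.snd (allFEdges F n) (piPlus F g n) ∧
        ENNReal.ofReal (1 - b n) ≤ μ.toOuterMeasure {ω | ∀ h ∈ ω.2, h.2 ⊆ ω.1} ∧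
        ∀ H₀ : Finset (FE n), (∀ h ∈ H₀, IsFEdge F n h) → ∀ h : FE n, IsFEdge F n h → h ∉ H₀ →
          μ.toOuterMeasure {ω | h.2 ⊆ ω.1 ∧ ω.2 = H₀} ≤
            ENNReal.ofReal ((pPlus F g δ n ^ ((h.2 \ H₀.sup Prod.snd).card) - piPlus F g n) /
              (1 - piPlus F g n)) * μ.toOuterMeasure {ω | ω.2 = H₀}
      then h.choose else PMF.pure (∅, ∅), ?_, ?_, ?_, ?_⟩
  · filter_upwards [hev] with n hn
    rw [dif_pos hn]
    exact hn.choose_spec.1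
  · filter_upwards [hev] with n hn
    rw [dif_pos hn]
    exact hn.choose_spec.2.1
  · have h1 : Tendsto (fun n => ENNReal.ofReal (1 - b n)) atTop (nhds 1) := by
      have h2 := ENNReal.tendsto_ofReal (hb.const_sub 1)
      rwa [sub_zero, ENNReal.ofReal_one] at h2
    refine tendsto_of_tendsto_of_tendsto_of_le_of_le' h1 tendsto_const_nhds ?_ ?_
    · filter_upwards [hev] with n hn
      rw [dif_pos hn]
      exact hn.choose_spec.2.2.1
    · refine Eventually.of_forall (fun n => ?_)
      refine (measure_mono (Set.subset_univ _)).trans (le_of_eq ?_)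
      rw [PMF.toOuterMeasure_apply_eq_one_iff]
      exact Set.subset_univ _
  · filter_upwards [hev] with n hn
    rw [dif_pos hn]
    intro H₀ _ hH₀ _ _ h hh hnot
    exact hn.choose_spec.2.2.2 H₀ hH₀ h hh hnot
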